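/- arXiv:2604.23738 — 4 statements merged into one kernel-verified Lean document; each statement's English description precedes it below -/
import Mathlib

section
/- For every n, r ∈ ℕ* there is a constant C(n,r) such that the following holds. If p is a prime, A is an n×m matrix with entries in ℤ/pℤ that satisfies the columns condition over ℤ/pℤ, and the set (ℤ/pℤ)* of nonzero residues is r-coloured in such a way that there is no x ∈ ((ℤ/pℤ)*)^m with Ax = 0 and x_1, …, x_m all the same colour, then p ≤ C(n,r). -/
/-- An `n × m` matrix `A` over a commutative ring `F` satisfies the columns condition
if there is a partition of its columns (encoded by a surjection `P : Fin m → Fin d`)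
such that for each part `j` the sum of the columns in part `j` lies in the span of the
columns in the earlier parts. -/
def ColumnsCondition {n m : ℕ} {F : Type*} [CommRing F] (A : Matrix (Fin n) (Fin m) F) : Prop :=
  ∃ d : ℕ, ∃ P : Fin m → Fin d, Function.Surjective P ∧
    ∀ j : Fin d,
      (∑ i ∈ Finset.univ.filter fun i => P i = j, fun k => A k i) ∈
        Submodule.span F {c : Fin n → F | ∃ i : Fin m, P i < j ∧ c = fun k => A k i}

/-- A finitary version of `Combinatorics.exists_mono_homothetic_copy`: the homothety can be chosen
from a finite set that does not depend on the colouring. -/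
theorem exists_finset_mono_homothetic_copy {M : Type*} (κ : Type*) [AddCommMonoid M] [Finite κ]
    (S : Finset M) :
    ∃ T : Finset (ℕ × M), ∀ C : M → κ,
      ∃ q ∈ T, 0 < q.1 ∧ ∃ c, ∀ s ∈ S, C (q.1 • s + q.2) = c := by
  classical
  obtain ⟨ι, _, hι⟩ := Combinatorics.Line.exists_mono_in_high_dimension S κ
  let q : (ι → Option S) → ℕ × M := fun f =>
    ((Finset.univ.filter fun i => f i = none).card, ∑ i, ((f i).map Subtype.val).getD 0)
  refine ⟨Finset.univ.image q, fun C => ?_⟩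
  obtain ⟨l, c, hl⟩ := hι fun v => C (∑ i, v i)
  refine ⟨q l.idxFun, Finset.mem_image_of_mem _ (Finset.mem_univ _), ?_, c, fun s hs => ?_⟩
  · obtain ⟨i, hi⟩ := l.proper
    exact Finset.card_pos.mpr ⟨i, by simpa using hi⟩
  · rw [← hl ⟨s, hs⟩]
    congr 1
    rw [← Finset.sum_const, Finset.sum_filter, ← Finset.sum_add_distrib]
    refine Finset.sum_congr rfl fun i _ => ?_
    cases h : l.idxFun i with
    | none => simp [h]
    | some y => simp [h]

/-- For every finite colouring of a commutative ring and every finite set `Λ` of coefficients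
there are `y 0, …, y M` such that the colour of `y j + ∑ k > j, l k * y k`, with coefficients `l k`
in `Λ`, depends only on `j`. Moreover, `y` can be chosen from a finite set that does not depend on
the colouring, with `y M` a bounded positive integer. -/
theorem exists_finset_mono_rows {R : Type*} (κ : Type*) [CommRing R] [Finite κ] (Λ : Finset R)
    (M : ℕ) :
    ∃ (B : ℕ) (Y : Finset (Fin (M + 1) → R)), ∀ χ : R → κ, ∃ y ∈ Y,
      (∃ b : ℕ, 0 < b ∧ b ≤ B ∧ y (Fin.last M) = b) ∧
      ∃ c : Fin (M + 1) → κ, ∀ j, ∀ l : Fin (M + 1) → R, (∀ k, l k ∈ Λ) →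
        χ (y j + ∑ k, if j < k then l k * y k else 0) = c j := by
  classical
  induction M with
  | zero =>
    refine ⟨1, {fun _ => 1}, fun χ => ⟨fun _ => 1, by simp, ⟨1, by simp⟩, fun _ => χ 1, ?_⟩⟩
    intro j l _
    simp [Subsingleton.elim (α := Fin 1) j 0]
  | succ M ih =>
    obtain ⟨B, Y, hY⟩ := ih
    let S : Finset R := (Fintype.piFinset (fun _ : Fin (M + 1) => Λ) ×ˢ Y).image
      fun u => ∑ k, u.1 k * u.2 k
    obtain ⟨T, hT⟩ := exists_finset_mono_homothetic_copy κ S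
    refine ⟨T.sup Prod.fst * B,
      (T ×ˢ Y).image fun u => Fin.cons u.1.2 fun k => u.1.1 • u.2 k, fun χ => ?_⟩
    obtain ⟨q, hqT, hq, c₀, hc₀⟩ := hT χ
    obtain ⟨z, hzY, ⟨b, hb, hbB, hzb⟩, c, hc⟩ := hY fun x => χ (q.1 • x)
    refine ⟨Fin.cons q.2 fun k => q.1 • z k,
      Finset.mem_image.mpr ⟨(q, z), Finset.mk_mem_product hqT hzY, rfl⟩,
      ⟨q.1 * b, Nat.mul_pos hq hb, Nat.mul_le_mul (Finset.le_sup (f := Prod.fst) hqT) hbB, ?_⟩,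
      Fin.cons c₀ c, fun j l hl => ?_⟩
    · rw [← Fin.succ_last, Fin.cons_succ, hzb]
      simp
    · rw [Fin.sum_univ_succ]
      cases j using Fin.cases with
      | zero =>
        have hmem : ∑ k, l (Fin.succ k) * z k ∈ S :=
          Finset.mem_image.mpr ⟨(fun k => l k.succ, z),
            Finset.mk_mem_product (Fintype.mem_piFinset.mpr fun k => hl _) hzY, rfl⟩
        simpa [Finset.mul_sum, mul_left_comm, add_comm] using hc₀ _ hmem
      | succ j =>
        simpa [Finset.mul_sum, mul_left_comm, mul_add] using hc j (fun k => l k.succ) fun k => hl _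

/-- A sequence of length exceeding `d` times the number of colours has a monochromatic subsequence
of length `d + 1`. -/
theorem exists_orderEmbedding_eq_const {κ : Type*} [Fintype κ] (d : ℕ)
    (c : Fin (Fintype.card κ * d + 1) → κ) :
    ∃ (e : Fin (d + 1) ↪o Fin (Fintype.card κ * d + 1)) (a : κ), ∀ s, c (e s) = a := by
  classical
  obtain ⟨a, ha⟩ := Fintype.exists_lt_card_fiber_of_mul_lt_card c (n := d) (by simp)
  obtain ⟨t, hts, ht⟩ := Finset.exists_subset_card_eq (Nat.succ_le_of_lt ha)
  exact ⟨t.orderEmbOfFin ht, a, fun s => by simpa using hts (t.orderEmbOfFin_mem ht s)⟩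

/-- If the positive integers up to some `B` are nonzero in `F`, then for every colouring of `F` and
every `φ : R →+* F` there are `y 0, …, y d` such that all `φ (y j + ∑ k > j, l k * y k)`, with
coefficients `l k` in `Λ`, are nonzero and have the same colour. Here `B` does not depend on `F`
and `φ`. -/
theorem exists_bound_mono_nonzero {R : Type*} (κ : Type*) [CommRing R] [Finite κ] (Λ : Finset R)
    (h0 : 0 ∈ Λ) (h1 : 1 ∈ Λ) (d : ℕ) :
    ∃ B : ℕ, ∀ {F : Type*} [CommRing F] (φ : R →+* F),
      (∀ b : ℕ, 0 < b → b ≤ B → (b : F) ≠ 0) → ∀ χ : F → κ,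
        ∃ (y : Fin (d + 1) → R) (c : κ), ∀ j, ∀ l : Fin (d + 1) → R, (∀ k, l k ∈ Λ) →
          φ (y j + ∑ k, if j < k then l k * y k else 0) ≠ 0 ∧
          χ (φ (y j + ∑ k, if j < k then l k * y k else 0)) = c := by
  classical
  have := Fintype.ofFinite κ
  obtain ⟨B, Y, hY⟩ := exists_finset_mono_rows (Prop × κ) Λ (Fintype.card (Prop × κ) * d)
  refine ⟨B, fun {F} _ φ hB χ => ?_⟩
  obtain ⟨y, -, ⟨b, hb, hbB, hyb⟩, c, hc⟩ := hY fun x => (φ x = 0, χ (φ x))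
  have hne : ∀ j, ∀ l : Fin _ → R, (∀ k, l k ∈ Λ) →
      φ (y j + ∑ k, if j < k then l k * y k else 0) ≠ 0 := by
    intro j l hl h
    have hcj : (c j).1 := by rw [← hc j l hl]; exact h
    have hz : φ (y j) = 0 := by
      have := hc j (fun _ => 0) fun _ => h0
      rw [← this] at hcj
      simpa using hcj
    have hbF : φ (y (Fin.last _)) ≠ 0 := by simpa [hyb] using hB b hb hbB
    rcases (Fin.le_last j).eq_or_lt with rfl | hj
    · exact hbF hz
    · have := hc j (Pi.single (Fin.last _) 1) fun k => by
        by_cases hk : k = Fin.last _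
        · subst hk; simpa using h1
        · simpa [hk] using h0
      rw [← this] at hcj
      apply hbF
      simpa [Pi.single_apply, ← ite_and, hz, Finset.sum_ite, Finset.filter_eq', hj,
        Finset.filter_and] using hcj
  obtain ⟨e, a, ha⟩ := exists_orderEmbedding_eq_const d c
  refine ⟨y ∘ e, a.2, fun j l hl => ?_⟩
  have hsum : (∑ k, if j < k then l k * (y ∘ e) k else 0) =
      ∑ k, if e j < k then Function.extend e l 0 k * y k else 0 := by
    refine Finset.sum_of_injOn e e.injective.injOn (by simp) ?_ ?_
    · intro k _ hk
      rw [Function.extend_apply' _ _ _ (by simpa using hk)]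
      simp
    · intro k _
      simp [e.injective.extend_apply]
  have hl' : ∀ k, Function.extend e l 0 k ∈ Λ := by
    intro k
    by_cases hk : ∃ s, e s = k
    · obtain ⟨s, rfl⟩ := hk
      rw [e.injective.extend_apply]
      exact hl s
    · rwa [Function.extend_apply' _ _ _ hk]
  rw [hsum]
  refine ⟨hne _ _ hl', ?_⟩
  rw [← ha j, ← hc (e j) _ hl']
  rfl

open Module in
/-- The parts in the columns condition can be taken to be indexed by `0, …, n`, at the price of
allowing empty parts. -/
theorem ColumnsCondition.exists_fin_succ {n m : ℕ} {F : Type*} [Field F]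
    {A : Matrix (Fin n) (Fin m) F} (hA : ColumnsCondition A) :
    ∃ Q : Fin m → Fin (n + 1), ∀ s : Fin (n + 1),
      (∑ i with Q i = s, A.col i) ∈ Submodule.span F {v | ∃ i, Q i < s ∧ v = A.col i} := by
  classical
  obtain ⟨d, P, -, hP⟩ := hA
  let V : Fin d → Submodule F (Fin n → F) := fun j =>
    Submodule.span F {v | ∃ i, P i < j ∧ v = A.col i}
  have hVmono : Monotone V := fun j k hjk =>
    Submodule.span_mono fun v ⟨i, hi, hv⟩ => ⟨i, hi.trans_le hjk, hv⟩
  have hrank : ∀ j, finrank F (V j) < n + 1 := fun j =>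
    Nat.lt_succ_of_le ((Submodule.finrank_le _).trans_eq (by simp))
  let f : Fin d → Fin (n + 1) := fun j => ⟨finrank F (V j), hrank j⟩
  have hfmono : Monotone f := fun j k hjk => Submodule.finrank_mono (hVmono hjk)
  refine ⟨fun i => f (P i), fun s => ?_⟩
  have hsum : (∑ i with f (P i) = s, A.col i) = ∑ j with f j = s, ∑ i with P i = j, A.col i := by
    rw [Finset.sum_comm' (t' := Finset.univ.filter fun i => f (P i) = s) (s' := fun i => {P i})]
    · simp
    · intro j i
      simp only [Finset.mem_filter, Finset.mem_univ, true_and, Finset.mem_singleton]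
      constructor
      · rintro ⟨h, rfl⟩
        exact ⟨rfl, h⟩
      · rintro ⟨rfl, h⟩
        exact ⟨h, rfl⟩
  rw [hsum]
  refine Submodule.sum_mem _ fun j hj => ?_
  rw [Finset.mem_filter] at hj
  obtain ⟨k, hk, hkmin⟩ := exists_minimal_of_wellFoundedLT (fun j => f j = s) ⟨j, hj.2⟩
  have hkj : k ≤ j := (le_total k j).elim id fun h => hkmin hj.2 h
  have hV : V k = V j := Submodule.eq_of_le_of_finrank_eq (hVmono hkj)
    (Fin.val_eq_of_eq (hk.trans hj.2.symm))
  have hmem : (∑ i with P i = j, A.col i) ∈ V k := hV ▸ hP j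
  refine Submodule.span_mono ?_ hmem
  rintro v ⟨i, hi, rfl⟩
  refine ⟨i, lt_of_le_of_ne ((hfmono hi.le).trans_eq hk) fun h => ?_, rfl⟩
  exact (hkmin h hi.le).not_gt hi

/-- A vector in the span of a family of vectors of `Fⁿ` is a linear combination of `n` of them. -/
theorem exists_fun_fin_of_mem_span {n m : ℕ} {F : Type*} [Field F] (v : Fin m → Fin n → F)
    (p : Fin m → Prop) {w : Fin n → F} (hw : w ∈ Submodule.span F {u | ∃ i, p i ∧ u = v i}) :
    ∃ (μ : Fin m → F) (a : Fin n → F), (∀ i, ¬ p i → μ i = 0) ∧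
      (∀ i, μ i = 0 ∨ ∃ t, μ i = a t) ∧ ∑ i, μ i • v i = w := by
  classical
  obtain ⟨f, hf, hspan, -⟩ :=
    Submodule.exists_fun_fin_finrank_span_eq F {u | ∃ i, p i ∧ u = v i}
  rw [← hspan, Submodule.mem_span_range_iff_exists_fun] at hw
  obtain ⟨b, rfl⟩ := hw
  choose g hg hgv using hf
  have hle : Module.finrank F (Submodule.span F {u | ∃ i, p i ∧ u = v i}) ≤ n :=
    (Submodule.finrank_le _).trans_eq (by simp)
  let μ : Fin m → F := fun i => ∑ t with g t = i, b t
  refine ⟨μ, fun t => if h : t.1 < _ then μ (g ⟨t, h⟩) else 0, fun i hi => ?_, fun i => ?_, ?_⟩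
  · exact Finset.sum_eq_zero fun t ht => absurd ((Finset.mem_filter.mp ht).2 ▸ hg t) hi
  · by_cases hi : ∃ t, g t = i
    · obtain ⟨t, rfl⟩ := hi
      exact Or.inr ⟨t.castLE hle, by simp⟩
    · exact Or.inl (Finset.sum_eq_zero fun t ht => absurd ⟨t, (Finset.mem_filter.mp ht).2⟩ hi)
  · simp only [μ, Finset.sum_smul, Finset.sum_filter, ite_smul, zero_smul]
    rw [Finset.sum_comm]
    simp [hgv]

/-- For every `n, r ≥ 1` there is `C = C(n,r)` such that: if `p` is prime, `A` is an
`n × m` matrix over `ℤ/pℤ` satisfying the columns condition, and `(ℤ/pℤ)*` is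
`r`-coloured with no monochromatic solution (in nonzero residues) of `Ax = 0`,
then `p ≤ C`. -/
theorem modular_rado_bounded (n r : ℕ) (hn : 0 < n) (hr : 0 < r) :
    ∃ C : ℕ, ∀ p m : ℕ, p.Prime →
      ∀ A : Matrix (Fin n) (Fin m) (ZMod p), ColumnsCondition A →
        ∀ χ : ZMod p → Fin r,
          (¬ ∃ x : Fin m → ZMod p, (∀ i, x i ≠ 0) ∧ A.mulVec x = 0 ∧
            ∀ i j : Fin m, χ (x i) = χ (x j)) →
          p ≤ C := by
  classical
  let R := MvPolynomial (Fin (n + 1) × Fin n) ℤ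
  let Λ : Finset R := insert 0 (insert 1 (Finset.univ.image MvPolynomial.X))
  obtain ⟨B, hB⟩ := exists_bound_mono_nonzero (Fin r) Λ (by simp [Λ]) (by simp [Λ]) n
  refine ⟨B, fun p m hp A hA χ hχ => ?_⟩
  by_contra! hpB
  have := Fact.mk hp
  apply hχ
  obtain ⟨Q, hQ⟩ := hA.exists_fin_succ
  choose μ a hμ hμa hsum using fun s =>
    exists_fun_fin_of_mem_span A.col (fun i => Q i < s) (Submodule.neg_mem _ (hQ s))
  let φ : R →+* ZMod p := MvPolynomial.eval₂Hom (Int.castRingHom _) fun t => a t.1 t.2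
  obtain ⟨y, c, hy⟩ := hB φ (fun b hb hbB h => by
    rw [ZMod.natCast_eq_zero_iff] at h
    exact absurd (Nat.le_of_dvd hb h) (by omega)) χ
  have hlift : ∀ i s, ∃ l ∈ Λ, φ l = μ s i := by
    intro i s
    rcases hμa s i with h | ⟨t, h⟩
    · exact ⟨0, by simp [Λ], by simp [h]⟩
    · exact ⟨MvPolynomial.X (s, t), by simp [Λ], h ▸ MvPolynomial.eval₂Hom_X' _ _ _⟩
  choose l hl hφl using hlift
  refine ⟨fun i => φ (y (Q i) + ∑ k, if Q i < k then l i k * y k else 0),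
    fun i => (hy _ _ (hl i)).1, ?_, fun i j => ?_⟩
  · have hx : ∀ i, φ (y (Q i) + ∑ k, if Q i < k then l i k * y k else 0) =
        ∑ k, ((if Q i = k then 1 else 0) + μ k i) * φ (y k) := by
      intro i
      simp only [map_add, map_sum, add_mul, Finset.sum_add_distrib, ite_mul, one_mul, zero_mul,
        Finset.sum_ite_eq, Finset.mem_univ, if_true]
      congr 1
      refine Finset.sum_congr rfl fun k _ => ?_
      split_ifs with h
      · simp [hφl]
      · simp [hμ k i h]
    have hcol : ∀ k, ∑ i, ((if Q i = k then 1 else 0) + μ k i) • A.col i = 0 := by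
      intro k
      simp only [add_smul, Finset.sum_add_distrib, hsum, ite_smul, one_smul, zero_smul,
        ← Finset.sum_filter, add_neg_cancel]
    have hmul : A.mulVec (fun i => ∑ k, ((if Q i = k then 1 else 0) + μ k i) * φ (y k)) =
        ∑ k, φ (y k) • ∑ i, ((if Q i = k then 1 else 0) + μ k i) • A.col i := by
      ext u
      simp only [Matrix.mulVec, dotProduct, Finset.sum_apply, Pi.smul_apply, smul_eq_mul,
        Finset.mul_sum, Matrix.col_apply]
      rw [Finset.sum_comm]
      exact Finset.sum_congr rfl fun k _ => Finset.sum_congr rfl fun i _ => by ring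
    simp only [hx, hmul, hcol, smul_zero, Finset.sum_const_zero]
  · exact (hy _ _ (hl i)).2.trans (hy _ _ (hl j)).2.symm
end

section
/- For every n, r ∈ ℕ* there is a constant C(n,r) such that the following holds. If 𝔽 is a finite field, 𝔽* := 𝔽 \ {0} is r-coloured, A is an n×m matrix with entries in 𝔽 satisfying the columns condition over 𝔽, and there is no x ∈ (𝔽*)^m with Ax = 0 and x_1,…,x_m all the same colour, then |𝔽| ≤ C(n,r). -/
open Finset Combinatorics

/-- In a sufficiently large finite field one can choose elements indexed by a given finite set
all of whose nonempty subset sums are nonzero. -/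
theorem exists_subset_sums_ne_zero {F ι : Type*} [Field F] [Fintype F] [DecidableEq ι]
    (s : Finset ι) (hs : 2 ^ #s < Fintype.card F) :
    ∃ μ : ι → F, ∀ B ⊆ s, B.Nonempty → ∑ i ∈ B, μ i ≠ 0 := by
  classical
  induction s using Finset.induction_on with
  | empty => exact ⟨0, fun B hB hne => absurd (subset_empty.1 hB) hne.ne_empty⟩
  | insert a s ha ih =>
    have hlt : 2 ^ #s < Fintype.card F :=
      (Nat.pow_le_pow_right two_pos (card_le_card (subset_insert a s))).trans_lt hs
    obtain ⟨μ, hμ⟩ := ih hlt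
    obtain ⟨v, hv⟩ : ∃ v, v ∉ s.powerset.image fun B => -∑ i ∈ B, μ i := by
      by_contra! hcon
      have hcard := card_image_le (s := s.powerset) (f := fun B => -∑ i ∈ B, μ i)
      rw [eq_univ_iff_forall.2 hcon, card_univ, card_powerset] at hcard
      omega
    have hupdate : ∀ B : Finset ι, a ∉ B →
        ∑ i ∈ B, Function.update μ a v i = ∑ i ∈ B, μ i := fun B haB =>
      sum_congr rfl fun i hi => Function.update_of_ne (ne_of_mem_of_not_mem hi haB) _ _
    refine ⟨Function.update μ a v, fun B hB hne => ?_⟩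
    by_cases haB : a ∈ B
    · rw [← add_sum_erase _ _ haB, hupdate _ (notMem_erase a B), Function.update_self]
      intro hzero
      refine hv (mem_image.2 ⟨B.erase a, mem_powerset.2 ?_, ?_⟩)
      · exact (erase_subset_erase a hB).trans (erase_insert_subset a s)
      · exact (eq_neg_of_add_eq_zero_left hzero).symm
    · rw [hupdate B haB]
      exact hμ B ((subset_insert_iff_of_notMem haB).1 hB) hne

/-- A weighted sum of coordinates maps a combinatorial line to an affine line. -/
theorem sum_mul_line {F α ι : Type*} [Field F] [Fintype ι] (μ : ι → F) (t : α → F)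
    (l : Line α ι) (a₀ x : α) (ha₀ : t a₀ = 0) :
    ∑ i, μ i * t (l x i) =
      ∑ i, μ i * t (l a₀ i) + (∑ i with l.idxFun i = none, μ i) * t x := by
  rw [sum_mul, sum_filter, ← sum_add_distrib]
  refine sum_congr rfl fun i _ => ?_
  cases h : l.idxFun i <;> simp [h, ha₀]

/-- A colour-by-rows Deuber theorem for finite fields. For a bounded set of coefficients, every
large finite field contains a bounded set such that for every colouring separating `0` from the
other elements there are nonzero `y₀, …, y_{D-1}` in that set with the colour of
`yᵢ + ∑_{k > i} cₖ yₖ` depending only on `i`. The bounded sets are given as images of fixed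
finite types. -/
theorem exists_rows_monochromatic (κ γ : Type) [Finite κ] [Fintype γ] (D : ℕ) :
    ∃ (σ : Type) (_ : Fintype σ) (C : ℕ), ∀ (F : Type) [Field F] [Fintype F],
      C < Fintype.card F → ∀ g : γ → F, ∃ s : σ → F, ∀ χ : F → κ,
        (∀ x, χ x = χ 0 → x = 0) →
        ∃ y : Fin D → F, (∀ i, y i ∈ Set.range s) ∧ (∀ i, y i ≠ 0) ∧
          ∀ i, ∀ c : Fin D → F, (∀ k ≤ i, c k = 0) → (∀ k, i < k → c k ∈ Set.range g) →
            χ (y i + ∑ k, c k * y k) = χ (y i) := by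
  classical
  induction D with
  | zero =>
    exact ⟨Empty, inferInstance, 0, fun F _ _ _ _ =>
      ⟨Empty.elim, fun _ _ => ⟨Fin.elim0, fun i => i.elim0, fun i => i.elim0, fun i => i.elim0⟩⟩⟩
  | succ D ih =>
    obtain ⟨σ, _, C, hσ⟩ := ih
    obtain ⟨ι, _, hι⟩ := Line.exists_mono_in_high_dimension
      (Option (Option ((Fin D → γ) × (Fin D → σ)))) κ
    refine ⟨(ι → Option (Option ((Fin D → γ) × (Fin D → σ)))) ⊕ (Finset ι × σ), inferInstance,
      max C (2 ^ #(univ : Finset ι)), fun F _ _ hF g => ?_⟩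
    obtain ⟨s, hs⟩ := hσ F ((le_max_left _ _).trans_lt hF) g
    obtain ⟨μ, hμ⟩ := exists_subset_sums_ne_zero (F := F) (univ : Finset ι)
      ((le_max_right _ _).trans_lt hF)
    let t : Option (Option ((Fin D → γ) × (Fin D → σ))) → F := fun o =>
      o.elim 0 fun o => o.elim 1 fun p => ∑ k, g (p.1 k) * s (p.2 k)
    refine ⟨Sum.elim (fun w => ∑ i, μ i * t (w i)) fun p => (∑ i ∈ p.1, μ i) * s p.2,
      fun χ hχ => ?_⟩
    obtain ⟨l, col, hl⟩ := hι fun w => χ (∑ i, μ i * t (w i))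
    set lam : F := ∑ i with l.idxFun i = none, μ i with hlam_def
    have hlam : lam ≠ 0 :=
      hμ _ (subset_univ _) (l.proper.imp fun i hi => mem_filter.2 ⟨mem_univ i, hi⟩)
    set z : F := ∑ i, μ i * t (l none i) with hz_def
    have hcol : ∀ x, χ (z + lam * t x) = χ z := fun x =>
      (congrArg χ (sum_mul_line μ t l none x rfl)).symm.trans ((hl x).trans (hl none).symm)
    obtain ⟨y, hy_mem, hy_ne, hy⟩ := hs (fun x => χ (lam * x)) fun x hx =>
      (mul_eq_zero.1 (hχ _ (by simpa using hx))).resolve_left hlam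
    refine ⟨Fin.cons z fun i => lam * y i, Fin.cases ?_ fun i => ?_, Fin.cases ?_ fun i => ?_,
      Fin.cases ?_ fun i => ?_⟩
    · exact ⟨Sum.inl (l none), rfl⟩
    · obtain ⟨a, ha⟩ := hy_mem i
      exact ⟨Sum.inr (univ.filter fun i => l.idxFun i = none, a), by simp [ha, hlam_def]⟩
    · intro hz
      rw [Fin.cons_zero] at hz
      have hone := hcol (some none)
      rw [hz, zero_add] at hone
      exact hlam (by simpa [t] using hχ _ hone)
    · simpa using ⟨hlam, hy_ne i⟩
    · intro c hc0 hc
      choose a ha using hy_mem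
      choose b hb using fun k : Fin D => hc k.succ k.succ_pos
      have hx : t (some (some (b, a))) = ∑ k, c k.succ * y k := by simp [t, ha, hb]
      have := hcol (some (some (b, a)))
      rw [hx, mul_sum] at this
      simpa [Fin.sum_univ_succ, hc0 0 le_rfl, mul_left_comm] using this
    · intro c hc0 hc
      have := hy i (fun k => c k.succ) (fun k hk => hc0 _ (Fin.succ_le_succ_iff.2 hk))
        fun k hk => hc _ (Fin.succ_lt_succ_iff.2 hk)
      simpa [Fin.sum_univ_succ, hc0 0 (Fin.zero_le _), mul_add, mul_sum, mul_left_comm] using this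

/-- A Deuber theorem for finite fields: for a bounded set of coefficients containing `0` and a
large enough finite field, there are `y₀, …, y_{d-1}` such that all the elements
`yᵢ + ∑_{k > i} cₖ yₖ` are nonzero and have the same colour. -/
theorem exists_deuber_monochromatic (γ : Type) [Fintype γ] (d r : ℕ) :
    ∃ C : ℕ, ∀ (F : Type) [Field F] [Fintype F], C < Fintype.card F →
      ∀ g : γ → F, (0 : F) ∈ Set.range g → ∀ χ : F → Fin r,
        ∃ (y : Fin d → F) (col : Fin r), ∀ i, ∀ c : Fin d → F,
          (∀ k ≤ i, c k = 0) → (∀ k, c k ∈ Set.range g) →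
            y i + ∑ k, c k * y k ≠ 0 ∧ χ (y i + ∑ k, c k * y k) = col := by
  classical
  obtain ⟨σ, _, C, hC⟩ := exists_rows_monochromatic (Option (Fin r)) γ (r * d)
  refine ⟨C, fun F _ _ hF g hg χ => ?_⟩
  obtain ⟨s, hs⟩ := hC F hF g
  have hsep : ∀ x : F, (if x = 0 then none else some (χ x)) =
      (if (0 : F) = 0 then none else some (χ 0)) → x = 0 := by
    intro x hx
    by_contra hne
    simp [hne] at hx
  obtain ⟨y, -, hy_ne, hy⟩ := hs (fun x => if x = 0 then none else some (χ x)) hsep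
  have : Nonempty (Fin r) := ⟨χ 0⟩
  obtain ⟨col, hcol⟩ := Fintype.exists_le_card_fiber_of_mul_le_card (fun i => χ (y i))
    (n := d) (by simp)
  let e := Finset.orderEmbOfCardLe _ hcol
  have he : ∀ i, χ (y (e i)) = col := fun i =>
    (mem_filter.1 (Finset.orderEmbOfCardLe_mem _ hcol i)).2
  refine ⟨fun i => y (e i), col, fun i c hc0 hc => ?_⟩
  have hsum : ∑ k, c k * y (e k) = ∑ k, Function.extend e c 0 k * y k := by
    refine sum_of_injOn e e.injective.injOn (by simp) (fun k _ hk => ?_) fun k _ => ?_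
    · rw [Function.extend_apply' _ _ _ fun ⟨j, hj⟩ => hk ⟨j, by simp, hj⟩]
      simp
    · rw [e.injective.extend_apply]
  have hrow := hy (e i) (Function.extend e c 0) (fun k hk => ?_) fun k _ => ?_
  · rw [hsum]
    simp only [hy_ne, if_false, he] at hrow
    split_ifs at hrow with h
    exact ⟨h, Option.some_injective _ hrow⟩
  · by_cases hk' : ∃ j, e j = k
    · obtain ⟨j, rfl⟩ := hk'
      rw [e.injective.extend_apply]
      exact hc0 j (e.le_iff_le.1 hk)
    · exact Function.extend_apply' _ _ _ hk'
  · by_cases hk' : ∃ j, e j = k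
    · obtain ⟨j, rfl⟩ := hk'
      rw [e.injective.extend_apply]
      exact hc j
    · rw [Function.extend_apply' _ _ _ hk']
      exact hg

/-- A vector in the span of a family restricted to `S` is a linear combination of that family
supported in `S` whose nonzero coefficients take at most `finrank` values. -/
theorem exists_sparse_combination {F V ι : Type*} [Field F] [AddCommGroup V] [Module F V]
    [FiniteDimensional F V] [Fintype ι] {d : ℕ} (hd : Module.finrank F V = d) (v : ι → V) (S : Set ι) {u : V}
    (hu : u ∈ Submodule.span F (v '' S)) :
    ∃ (l : ι → F) (b : Fin d → F), (∀ i ∉ S, l i = 0) ∧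
      (∀ i, l i = 0 ∨ l i ∈ Set.range b) ∧ ∑ i, l i • v i = u := by
  classical
  obtain ⟨B, hBS, -, hspan, hB⟩ :=
    exists_linearIndepOn_extension (linearIndepOn_empty F v) (Set.empty_subset S)
  obtain ⟨l, hlB, hl⟩ := (Finsupp.mem_span_image_iff_linearCombination F).1
    (Submodule.span_le.2 hspan hu)
  have hcard : Fintype.card B ≤ Fintype.card (Fin d) := by
    simpa [hd] using LinearIndependent.fintype_card_le_finrank hB
  obtain ⟨f⟩ := Function.Embedding.nonempty_of_card_le hcard
  have hzero : ∀ i ∉ B, l i = 0 := fun i hi =>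
    Finsupp.notMem_support_iff.1 fun h => hi (hlB h)
  refine ⟨l, Function.extend f (fun i => l i) 0, fun i hi => hzero i fun h => hi (hBS h),
    fun i => ?_, ?_⟩
  · by_cases hi : i ∈ B
    · exact Or.inr ⟨f ⟨i, hi⟩, f.injective.extend_apply _ _ _⟩
    · exact Or.inl (hzero i hi)
  · rw [← hl, Finsupp.linearCombination_apply, Finsupp.sum_fintype _ _ (by simp)]

/-- The partition in the columns condition may be coarsened to one with at most `n + 1`
(possibly empty) parts. -/
theorem ColumnsCondition.exists_bounded_partition {n m : ℕ} {F : Type*} [Field F]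
    {A : Matrix (Fin n) (Fin m) F} (hA : ColumnsCondition A) :
    ∃ Q : Fin m → Fin (n + 1), ∀ q,
      (∑ i with Q i = q, fun k => A k i) ∈
        Submodule.span F ((fun i k => A k i) '' {i | Q i < q}) := by
  classical
  obtain ⟨d, P, -, hP⟩ := hA
  let V : Fin d → Submodule F (Fin n → F) := fun j =>
    Submodule.span F {c : Fin n → F | ∃ i : Fin m, P i < j ∧ c = fun k => A k i}
  have hV : Monotone V := fun a b hab => Submodule.span_mono
    fun c ⟨i, hi, hc⟩ => ⟨i, hi.trans_le hab, hc⟩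
  let rk : Fin d → Fin (n + 1) := fun j =>
    ⟨Module.finrank F (V j), Nat.lt_succ_of_le (by simpa using (V j).finrank_le)⟩
  have hrk : Monotone rk := fun a b hab => Submodule.finrank_mono (hV hab)
  have hV_eq : ∀ a b, a ≤ b → rk a = rk b → V a = V b := fun a b hab h =>
    Submodule.eq_of_le_of_finrank_eq (hV hab) (congrArg Fin.val h)
  refine ⟨fun i => rk (P i), fun q => ?_⟩
  obtain hempty | hne := (univ.filter fun j => rk j = q).eq_empty_or_nonempty
  · rw [filter_eq_empty_iff.2 fun i _ h => ?_]
    · simp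
    · exact filter_eq_empty_iff.1 hempty (mem_univ (P i)) h
  · obtain ⟨j₀, hj₀, hmin⟩ := exists_min_image _ id hne
    have hj₀q : rk j₀ = q := (mem_filter.1 hj₀).2
    have hle : V j₀ ≤ Submodule.span F ((fun i k => A k i) '' {i | rk (P i) < q}) := by
      refine Submodule.span_mono ?_
      rintro c ⟨i, hi, rfl⟩
      refine ⟨i, lt_of_le_of_ne ((hrk hi.le).trans_eq hj₀q) fun h => ?_, rfl⟩
      exact absurd (hmin (P i) (by simpa using h)) (not_le.2 hi)
    refine hle ?_
    rw [← sum_fiberwise_of_maps_to (s := univ.filter fun i => rk (P i) = q)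
      (t := univ.filter fun j => rk j = q) (g := P) (by simp)]
    refine Submodule.sum_mem _ fun j hj => ?_
    have hjq : rk j = q := (mem_filter.1 hj).2
    have hfilter : ((univ.filter fun i => rk (P i) = q).filter fun i => P i = j) =
        univ.filter fun i => P i = j := by
      rw [filter_filter]
      exact filter_congr fun i _ => ⟨And.right, fun h => ⟨h ▸ hjq, h⟩⟩
    rw [hfilter, hV_eq j₀ j (hmin j hj) (hj₀q.trans hjq.symm)]
    exact hP j

/-- Combining kernel vectors indexed by the parts of a partition. -/
theorem mulVec_partition_eq_zero {n m d : ℕ} {F : Type*} [Field F]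
    (A : Matrix (Fin n) (Fin m) F) (Q : Fin m → Fin d) (l : Fin d → Fin m → F)
    (hl : ∀ q, ∑ i, l q i • (fun k => A k i) = ∑ i with Q i = q, fun k => A k i)
    (y : Fin d → F) :
    A.mulVec (fun i => y (Q i) + ∑ q, -l q i * y q) = 0 := by
  classical
  funext k
  have hlk : ∀ q, ∑ i, l q i * A k i = ∑ i with Q i = q, A k i := fun q => by
    simpa [Finset.sum_apply] using congrFun (hl q) k
  have hfirst : ∑ i, A k i * y (Q i) = ∑ q, (∑ i with Q i = q, A k i) * y q := by
    rw [← sum_fiberwise (s := univ) (g := Q)]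
    refine sum_congr rfl fun q _ => ?_
    rw [sum_mul]
    exact sum_congr rfl fun i hi => by rw [(mem_filter.1 hi).2]
  have hsecond : ∑ i, A k i * ∑ q, -l q i * y q = -∑ q, (∑ i, l q i * A k i) * y q := by
    simp_rw [mul_sum, sum_mul]
    rw [sum_comm, ← sum_neg_distrib]
    refine sum_congr rfl fun q _ => ?_
    rw [← sum_neg_distrib]
    exact sum_congr rfl fun i _ => by ring
  simp only [Matrix.mulVec, dotProduct, mul_add, sum_add_distrib, Pi.zero_apply]
  rw [hfirst, hsecond, sum_congr rfl fun q _ => by rw [← hlk q], add_neg_cancel]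

/-- For every `n, r ≥ 1` there is `C = C(n,r)` such that: if `𝔽` is a finite field,
`𝔽* = 𝔽 \ {0}` is `r`-coloured, `A` is an `n × m` matrix over `𝔽` satisfying the
columns condition, and there is no `x ∈ (𝔽*)^m` with `Ax = 0` and all coordinates the
same colour, then `|𝔽| ≤ C`. -/
theorem finite_field_rado_bounded (n r : ℕ) (hn : 0 < n) (hr : 0 < r) :
    ∃ C : ℕ, ∀ (𝔽 : Type) [Field 𝔽] [Fintype 𝔽], ∀ m : ℕ,
      ∀ A : Matrix (Fin n) (Fin m) 𝔽, ColumnsCondition A →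
        ∀ χ : 𝔽 → Fin r,
          (¬ ∃ x : Fin m → 𝔽, (∀ i, x i ≠ 0) ∧ A.mulVec x = 0 ∧
            ∀ i j : Fin m, χ (x i) = χ (x j)) →
          Fintype.card 𝔽 ≤ C := by
  obtain ⟨C, hC⟩ := exists_deuber_monochromatic (Option (Fin (n + 1) × Fin n)) (n + 1) r
  refine ⟨C, fun 𝔽 _ _ m A hA χ hno => ?_⟩
  by_contra! hcard
  obtain ⟨Q, hQ⟩ := hA.exists_bounded_partition
  choose l b hl_supp hl_mem hl_sum using fun q =>
    exists_sparse_combination (Module.finrank_fin_fun 𝔽) _ _ (hQ q)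
  obtain ⟨y, col, hy⟩ := hC 𝔽 hcard
    (fun o => o.elim 0 fun p => -b p.1 p.2) ⟨none, rfl⟩ χ
  have hx := fun i => hy (Q i) (fun q => -l q i)
    (fun q hq => by rw [hl_supp q i (not_lt.2 hq), neg_zero]) fun q => by
      rcases hl_mem q i with h | ⟨k, hk⟩
      · exact ⟨none, by simp [h]⟩
      · exact ⟨some (q, k), by simp [hk]⟩
  exact hno ⟨_, fun i => (hx i).1, mulVec_partition_eq_zero A Q l hl_sum y,
    fun i j => (hx i).2.trans (hx j).2.symm⟩
end

section
/- There is an absolute constant C > 0 such that the following holds. If p is a prime, A is a 1×m matrix with entries in ℤ/pℤ that satisfies the columns condition over ℤ/pℤ, and (ℤ/pℤ)* is r-coloured in such a way that there is no x ∈ ((ℤ/pℤ)*)^m with Ax = 0 and x_1,…,x_m all the same colour, then p ≤ exp((2r)^C). -/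
open Finset
open scoped Pointwise

section Averages

variable {G : Type*} [AddCommGroup G]

/-- The average of `f` over the translate `x + B`. -/
noncomputable def translateAvg (f : G → ℝ) (B : Finset G) (x : G) : ℝ :=
  (∑ b ∈ B, f (x + b)) / #B

lemma sum_translateAvg (f : G → ℝ) (B S : Finset G) (x : G) :
    ∑ b ∈ B, translateAvg f S (x + b) = (∑ u ∈ S, ∑ b ∈ B, f (x + (b + u))) / #S := by
  simp only [translateAvg]
  rw [← sum_div, sum_comm]
  simp only [add_assoc]

lemma card_mul_translateAvg (f : G → ℝ) {B : Finset G} (hB : B.Nonempty) (x : G) :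
    #B * translateAvg f B x = ∑ b ∈ B, f (x + b) := by
  have : (#B : ℝ) ≠ 0 := by exact_mod_cast hB.card_pos.ne'
  rw [translateAvg]; field_simp

lemma translateAvg_le_one {f : G → ℝ} (hf : ∀ x, |f x| ≤ 1) (B : Finset G) (x : G) :
    translateAvg f B x ≤ 1 := by
  refine div_le_one_of_le₀ ?_ (by positivity)
  calc _ ≤ ∑ b ∈ B, (1 : ℝ) := sum_le_sum fun b _ => (le_abs_self _).trans (hf _)
    _ = _ := by simp

variable [DecidableEq G]

/-- Adding the set `S` (which contains `0`) to `B` increases its size by a factor at most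
`1 + ε`. -/
def AlmostInvariant (ε : ℝ) (B S : Finset G) : Prop :=
  0 ∈ S ∧ (#(B + S) : ℝ) ≤ (1 + ε) * #B

lemma AlmostInvariant.mono {ε : ℝ} {B S S' : Finset G} (h : AlmostInvariant ε B S) (hS : S' ⊆ S)
    (h0 : (0 : G) ∈ S') : AlmostInvariant ε B S' :=
  ⟨h0, le_trans (by exact_mod_cast card_le_card (add_subset_add_left hS)) h.2⟩

lemma AlmostInvariant.norm_sum_shift_sub_le {E : Type*} [NormedAddCommGroup E] {ε : ℝ}
    {B S : Finset G} (h : AlmostInvariant ε B S) {u : G} (hu : u ∈ S) {g : G → E}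
    (hg : ∀ x, ‖g x‖ ≤ 1) :
    ‖∑ b ∈ B, g (b + u) - ∑ b ∈ B, g b‖ ≤ 2 * ε * #B := by
  have key : ∀ v ∈ S, ‖∑ b ∈ B + S, g b - ∑ b ∈ B, g (b + v)‖ ≤ ε * #B := by
    intro v hv
    have hsub : B.image (· + v) ⊆ B + S := by
      intro x hx
      obtain ⟨b, hb, rfl⟩ := mem_image.1 hx
      exact add_mem_add hb hv
    have hcard : #(B.image (· + v)) = #B := card_image_of_injective _ (add_left_injective v)
    have hsum : ∑ b ∈ B, g (b + v) = ∑ b ∈ B.image (· + v), g b := by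
      rw [sum_image]
      exact fun a _ b _ hab => add_left_injective v hab
    rw [hsum, ← sum_sdiff hsub, add_sub_cancel_right]
    calc _ ≤ ∑ b ∈ (B + S) \ B.image (· + v), ‖g b‖ := norm_sum_le _ _
      _ ≤ ∑ b ∈ (B + S) \ B.image (· + v), (1 : ℝ) := sum_le_sum fun b _ => hg b
      _ = #(B + S) - #B := by
        rw [sum_const, nsmul_eq_mul, mul_one, ← hcard, cast_card_sdiff hsub]
      _ ≤ ε * #B := by linarith [h.2]
  have h1 := key u hu
  have h2 := key 0 h.1
  simp only [add_zero] at h2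
  calc _ = ‖(∑ b ∈ B + S, g b - ∑ b ∈ B, g b) - (∑ b ∈ B + S, g b - ∑ b ∈ B, g (b + u))‖ := by
        congr 1; abel
    _ ≤ _ := norm_sub_le _ _
    _ ≤ _ := by linarith

lemma AlmostInvariant.sum_sub_le_sum_shift {ε : ℝ} {B S : Finset G} (h : AlmostInvariant ε B S)
    {u : G} (hu : u ∈ S) {g : G → ℝ} (hg : ∀ x, |g x| ≤ 1) :
    ∑ b ∈ B, g b - 2 * ε * #B ≤ ∑ b ∈ B, g (b + u) := by
  have := h.norm_sum_shift_sub_le hu (g := g) hg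
  rw [Real.norm_eq_abs, abs_le] at this
  linarith [this.1]

/-- Averaging over a set `S` absorbed by `B` loses almost nothing in the mean over `x + B`. -/
lemma AlmostInvariant.sum_translateAvg_ge {ε : ℝ} {B S : Finset G} (h : AlmostInvariant ε B S)
    {f : G → ℝ} (hf : ∀ x, |f x| ≤ 1) (x : G) :
    ∑ b ∈ B, f (x + b) - 2 * ε * #B ≤ ∑ b ∈ B, translateAvg f S (x + b) := by
  have hS : (0 : ℝ) < #S := by exact_mod_cast card_pos.2 ⟨0, h.1⟩
  rw [sum_translateAvg, le_div_iff₀ hS, mul_comm, ← nsmul_eq_mul]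
  refine card_nsmul_le_sum _ _ _ fun u hu => ?_
  exact h.sum_sub_le_sum_shift hu (g := fun b => f (x + b)) fun _ => hf _

lemma AlmostInvariant.exists_translateAvg_ge {ε : ℝ} {B S : Finset G} (h : AlmostInvariant ε B S)
    (hB : B.Nonempty) {f : G → ℝ} (hf : ∀ x, |f x| ≤ 1) (x : G) :
    ∃ y, translateAvg f B x - 2 * ε ≤ translateAvg f S y := by
  have h1 := h.sum_translateAvg_ge hf x
  rw [← card_mul_translateAvg f hB] at h1
  obtain ⟨b, -, hb⟩ := exists_le_of_sum_le hB
    (f := fun _ => translateAvg f B x - 2 * ε) (g := fun b => translateAvg f S (x + b))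
    (by rw [sum_const, nsmul_eq_mul]; linarith)
  exact ⟨_, hb⟩

end Averages

section Fourier

variable {G : Type*} [AddCommGroup G] [Fintype G] [DecidableEq G]

lemma sum_addChar_trilinear (u v z : G → ℂ) :
    ∑ γ : AddChar G ℂ, (∑ x, u x * γ x) * (∑ y, v y * γ y) * (∑ w, z w * γ (-w)) =
      Fintype.card G * ∑ x, ∑ y, u x * v y * z (x + y) := by
  have h : ∀ γ : AddChar G ℂ,
      (∑ x, u x * γ x) * (∑ y, v y * γ y) * (∑ w, z w * γ (-w)) =
        ∑ x, ∑ y, ∑ w, u x * v y * z w * γ (x + y - w) := by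
    intro γ
    rw [sum_mul_sum, sum_mul]
    refine sum_congr rfl fun x _ => ?_
    rw [sum_mul]
    refine sum_congr rfl fun y _ => ?_
    rw [mul_sum]
    refine sum_congr rfl fun w _ => ?_
    rw [sub_eq_add_neg, AddChar.map_add_eq_mul, AddChar.map_add_eq_mul]
    ring
  simp only [h]
  rw [sum_comm, mul_sum]
  refine sum_congr rfl fun x _ => ?_
  rw [sum_comm, mul_sum]
  refine sum_congr rfl fun y _ => ?_
  rw [sum_comm]
  simp only [← mul_sum, AddChar.sum_apply_eq_ite, sub_eq_zero]
  simp only [mul_ite, mul_zero, sum_ite_eq, mem_univ, if_true]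
  ring

lemma sum_norm_sq_addChar (v : G → ℂ) :
    ∑ γ : AddChar G ℂ, ‖∑ y, v y * γ y‖ ^ 2 = Fintype.card G * ∑ y, ‖v y‖ ^ 2 := by
  have h : ∀ γ : AddChar G ℂ, ((‖∑ y, v y * γ y‖ ^ 2 : ℝ) : ℂ) =
      ∑ x, ∑ y, v x * (starRingEnd ℂ) (v y) * γ (x - y) := by
    intro γ
    push_cast
    rw [← Complex.mul_conj', map_sum, sum_mul_sum]
    refine sum_congr rfl fun x _ => sum_congr rfl fun y _ => ?_
    rw [map_mul, ← AddChar.map_neg_eq_conj, sub_eq_add_neg, AddChar.map_add_eq_mul]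
    ring
  have h2 : ((∑ γ : AddChar G ℂ, ‖∑ y, v y * γ y‖ ^ 2 : ℝ) : ℂ) =
      ((Fintype.card G * ∑ y, ‖v y‖ ^ 2 : ℝ) : ℂ) := by
    rw [Complex.ofReal_sum]
    simp only [h]
    rw [sum_comm]
    push_cast
    rw [mul_sum]
    refine sum_congr rfl fun x _ => ?_
    rw [sum_comm]
    simp only [← mul_sum, AddChar.sum_apply_eq_ite, sub_eq_zero]
    simp only [mul_ite, mul_zero, sum_ite_eq, mem_univ, if_true]
    rw [Complex.mul_conj']
    ring
  exact_mod_cast h2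

lemma norm_sq_trilinear_le (u v z : G → ℂ) {M : ℝ}
    (hM : ∀ γ : AddChar G ℂ, ‖∑ x, u x * γ x‖ ≤ M) :
    ‖∑ x, ∑ y, u x * v y * z (x + y)‖ ^ 2 ≤ M ^ 2 * (∑ y, ‖v y‖ ^ 2) * ∑ y, ‖z y‖ ^ 2 := by
  set N : ℝ := (Fintype.card G : ℝ)
  have hN : 0 < N := by simpa [N] using Fintype.card_pos_iff.2 ⟨(0 : G)⟩
  have hM0 : 0 ≤ M := (norm_nonneg _).trans (hM 0)
  have hz : ∑ γ : AddChar G ℂ, ‖∑ w, z w * γ (-w)‖ ^ 2 = N * ∑ y, ‖z y‖ ^ 2 := by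
    rw [← Equiv.sum_comp (Equiv.neg (AddChar G ℂ))]
    simpa using sum_norm_sq_addChar z
  have h1 : N * ‖∑ x, ∑ y, u x * v y * z (x + y)‖ ≤
      M * ∑ γ : AddChar G ℂ, ‖∑ y, v y * γ y‖ * ‖∑ w, z w * γ (-w)‖ := by
    have := congrArg norm (sum_addChar_trilinear u v z)
    rw [norm_mul, Complex.norm_natCast] at this
    rw [← this, mul_sum]
    refine (norm_sum_le _ _).trans (sum_le_sum fun γ _ => ?_)
    rw [norm_mul, norm_mul, mul_assoc]
    exact mul_le_mul_of_nonneg_right (hM γ) (by positivity)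
  have h2 := sum_mul_sq_le_sq_mul_sq univ (fun γ : AddChar G ℂ => ‖∑ y, v y * γ y‖)
    (fun γ : AddChar G ℂ => ‖∑ w, z w * γ (-w)‖)
  rw [sum_norm_sq_addChar, hz] at h2
  have h3 : (N * ‖∑ x, ∑ y, u x * v y * z (x + y)‖) ^ 2 ≤
      M ^ 2 * ((N * ∑ y, ‖v y‖ ^ 2) * (N * ∑ y, ‖z y‖ ^ 2)) := by
    refine (pow_le_pow_left₀ (by positivity) h1 2).trans ?_
    rw [mul_pow]
    exact mul_le_mul_of_nonneg_left h2 (by positivity)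
  have h4 : N ^ 2 * ‖∑ x, ∑ y, u x * v y * z (x + y)‖ ^ 2 ≤
      N ^ 2 * (M ^ 2 * (∑ y, ‖v y‖ ^ 2) * ∑ y, ‖z y‖ ^ 2) := by
    calc _ = _ := by rw [← mul_pow]
      _ ≤ _ := h3
      _ = _ := by ring
  exact le_of_mul_le_mul_left h4 (by positivity)

end Fourier

section Increment

variable {G : Type*} [AddCommGroup G] [Fintype G] [DecidableEq G]

/-- If `A` has density `α` near `B₀` and nowhere more than `α + η` on translates of `B'`, then
either `A - A` meets a given dense subset of `B` or some character is biased on `A` inside a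
translate of `B'` on which `A` has density about `α`. -/
lemma exists_addChar_bias {A B₀ B B' T : Finset G} {f : G → ℝ}
    (hf : ∀ x, f x = if x ∈ A then 1 else 0) {α τ ε η κ : ℝ} (hα : 0 < α) (hτ : 0 < τ)
    (hκα : 64 * κ ^ 2 ≤ α ^ 4 * τ) (hεη : 4 * ε + η ≤ α / 2)
    (hB₀ : B₀.Nonempty)
    (h₀ : AlmostInvariant ε B₀ (B + B')) (h₁ : AlmostInvariant 1 B B') (hTB : T ⊆ B)
    (hB0 : 0 ∈ B) (hT : τ * #B ≤ #T) (hTA : ∀ t ∈ T, ∀ a ∈ A, a + t ∉ A) {x₀ : G}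
    (hx₀ : α ≤ translateAvg f B₀ x₀) (hη : ∀ x, translateAvg f B' x ≤ α + η) :
    ∃ w : G, α - 4 * ε - η ≤ translateAvg f B' w ∧ ∃ γ : AddChar G ℂ,
      κ * #B' ≤ ‖∑ b ∈ B', ((f (w + b) - translateAvg f B' w : ℝ) : ℂ) * γ b‖ := by
  have hf1 : ∀ x, |f x| ≤ 1 := fun x => by rw [hf]; split_ifs <;> simp
  have hB'0 : (0 : G) ∈ B' := h₁.1
  have hBpos : (0 : ℝ) < #B := by exact_mod_cast card_pos.2 ⟨0, hB0⟩
  have hB'pos : (0 : ℝ) < #B' := by exact_mod_cast card_pos.2 ⟨0, hB'0⟩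
  have hTpos : (0 : ℝ) < #T := lt_of_lt_of_le (by positivity) hT
  have hB₀pos : (0 : ℝ) < #B₀ := by exact_mod_cast hB₀.card_pos
  have hshift : ∀ t ∈ B, (α - 2 * ε) * #B₀ ≤
      ∑ x ∈ B₀, translateAvg f B' (x₀ + x + t) := by
    intro t ht
    have h1 : ∀ u ∈ B', (α - 2 * ε) * #B₀ ≤ ∑ x ∈ B₀, f (x₀ + (x + (t + u))) := by
      intro u hu
      have := h₀.sum_sub_le_sum_shift (add_mem_add ht hu) (g := fun b => f (x₀ + b))
        fun _ => hf1 _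
      rw [← card_mul_translateAvg f hB₀] at this
      nlinarith
    have h2 : ∑ x ∈ B₀, translateAvg f B' (x₀ + x + t) =
        (∑ u ∈ B', ∑ x ∈ B₀, f (x₀ + (x + (t + u)))) / #B' := by
      simp only [translateAvg]
      rw [← sum_div, sum_comm]
      simp only [add_assoc]
    rw [h2, le_div_iff₀ hB'pos, mul_comm, ← nsmul_eq_mul]
    exact card_nsmul_le_sum _ _ _ h1
  obtain ⟨x, -, hx⟩ : ∃ x ∈ B₀, 2 * (α - 2 * ε) ≤ translateAvg f B' (x₀ + x) +
      (∑ t ∈ T, translateAvg f B' (x₀ + x + t)) / #T := by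
    refine exists_le_of_sum_le hB₀ ?_
    rw [sum_const, nsmul_eq_mul, sum_add_distrib, ← sum_div, sum_comm]
    have h1 := hshift 0 hB0
    simp only [add_zero] at h1
    have h2 : (α - 2 * ε) * #B₀ ≤
        (∑ t ∈ T, ∑ x ∈ B₀, translateAvg f B' (x₀ + x + t)) / #T := by
      rw [le_div_iff₀ hTpos, mul_comm, ← nsmul_eq_mul]
      exact card_nsmul_le_sum _ _ _ fun t ht => hshift t (hTB ht)
    linarith
  set w := x₀ + x with hw
  set a := translateAvg f B' w with ha
  have hTle : (∑ t ∈ T, translateAvg f B' (w + t)) / #T ≤ α + η := by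
    rw [div_le_iff₀ hTpos, mul_comm, ← nsmul_eq_mul]
    exact sum_le_card_nsmul _ _ _ fun t _ => hη _
  have ha_le := hη w
  have ha_ge : α - 4 * ε - η ≤ a := by linarith
  have hT_ge : α / 2 * #T ≤ ∑ t ∈ T, translateAvg f B' (w + t) := by
    rw [← le_div_iff₀ hTpos]; linarith
  refine ⟨w, ha_ge, ?_⟩
  by_contra! hcon
  let u : G → ℂ := fun b => if b ∈ B' then ((f (w + b) - a : ℝ) : ℂ) else 0
  let v : G → ℂ := fun t => if t ∈ T then 1 else 0
  let z : G → ℂ := fun y => if y ∈ B + B' then ((f (w + y) : ℝ) : ℂ) else 0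
  have hu : ∀ γ : AddChar G ℂ, ‖∑ x, u x * γ x‖ ≤ κ * #B' := by
    intro γ
    have : ∑ x, u x * γ x = ∑ b ∈ B', ((f (w + b) - a : ℝ) : ℂ) * γ b := by
      simp only [u, ite_mul, zero_mul]
      rw [sum_ite_mem, univ_inter]
    rw [this]
    exact (hcon γ).le
  have hmain := norm_sq_trilinear_le u v z hu
  have hv2 : ∑ y, ‖v y‖ ^ 2 = #T := by
    have : ∀ y, ‖v y‖ ^ 2 = if y ∈ T then (1 : ℝ) else 0 := fun y => by
      simp only [v]; split_ifs <;> simp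
    simp [this]
  have hz2 : ∑ y, ‖z y‖ ^ 2 ≤ 2 * #B := by
    have h1 : ∀ y, ‖z y‖ ^ 2 ≤ if y ∈ B + B' then (1 : ℝ) else 0 := fun y => by
      simp only [z]
      split_ifs
      · rw [Complex.norm_real]
        exact pow_le_one₀ (norm_nonneg _) (hf1 _)
      · simp
    refine (sum_le_sum fun y _ => h1 y).trans ?_
    have := h₁.2
    simp only [sum_boole, filter_mem_eq_inter, univ_inter]
    linarith
  have hsum : ∑ x, ∑ y, u x * v y * z (x + y) =
      ((-(a * (#B' * ∑ t ∈ T, translateAvg f B' (w + t))) : ℝ) : ℂ) := by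
    have h1 : ∀ x, ∑ y, u x * v y * z (x + y) =
        if x ∈ B' then ∑ t ∈ T, ((-(a * f (w + t + x)) : ℝ) : ℂ) else 0 := by
      intro x
      simp only [u, v]
      split_ifs with hx
      · simp only [mul_ite, mul_one, mul_zero, ite_mul, zero_mul]
        rw [sum_ite_mem, univ_inter]
        refine sum_congr rfl fun t ht => ?_
        have hmem : x + t ∈ B + B' := by
          rw [add_comm x t]; exact add_mem_add (hTB ht) hx
        have h3 : f (w + x) * f (w + t + x) = 0 := by
          rw [hf, hf]
          split_ifs with h4 h5
          · exact absurd (by rwa [add_right_comm]) (hTA t ht _ h4)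
          all_goals simp
        simp only [z, if_pos hmem]
        rw [← Complex.ofReal_mul]
        congr 1
        rw [show w + (x + t) = w + t + x by abel, sub_mul, h3]
        ring
      · simp
    simp only [h1]
    rw [sum_ite_mem, univ_inter, sum_comm]
    simp only [mul_sum, card_mul_translateAvg f ⟨0, hB'0⟩]
    push_cast
    simp only [sum_neg_distrib]
  rw [hsum, Complex.norm_real, norm_neg, Real.norm_eq_abs, sq_abs, hv2] at hmain
  have hlow : α / 2 * (#B' * (α / 2 * #T)) ≤
      a * (#B' * ∑ t ∈ T, translateAvg f B' (w + t)) := by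
    have h3 : α / 2 ≤ a := by linarith
    have h4 : 0 ≤ a := by linarith
    gcongr
  have h5 : (α / 2 * (#B' * (α / 2 * #T))) ^ 2 ≤ (κ * #B') ^ 2 * #T * (2 * #B) :=
    (pow_le_pow_left₀ (by positivity) hlow 2).trans
      (hmain.trans (mul_le_mul_of_nonneg_left hz2 (by positivity)))
  have h6 : (#B' : ℝ) ^ 2 * #T * (α ^ 4 * #T) ≤ (#B' : ℝ) ^ 2 * #T * (32 * κ ^ 2 * #B) := by
    nlinarith
  have h7 : α ^ 4 * #T ≤ 32 * κ ^ 2 * #B := le_of_mul_le_mul_left h6 (by positivity)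
  have h8 : α ^ 4 * (τ * #B) ≤ α ^ 4 * #T := by gcongr
  have h9 : 64 * κ ^ 2 * #B ≤ α ^ 4 * τ * #B := by gcongr
  have h10 : 0 < α ^ 4 * τ * #B := by positivity
  nlinarith

/-- A biased character on a translate of `B'` gives increased density on a translate of any set
`B''` which almost fixes `B'` and on which the character is nearly trivial. -/
lemma exists_translateAvg_increment {B' B'' : Finset G} {f : G → ℝ}
    (hf0 : ∀ x, 0 ≤ f x) (hf1 : ∀ x, f x ≤ 1) {ε κ : ℝ} (hεκ : 16 * ε ≤ κ) (hκ : 0 < κ)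
    (hB' : B'.Nonempty) (h : AlmostInvariant ε B' B'') {w : G} {γ : AddChar G ℂ}
    (hγ : κ * #B' ≤ ‖∑ b ∈ B', ((f (w + b) - translateAvg f B' w : ℝ) : ℂ) * γ b‖)
    (hB'' : ∀ u ∈ B'', ‖γ u - 1‖ ≤ κ / 4) :
    ∃ s, translateAvg f B' w + κ / 4 ≤ translateAvg f B'' s := by
  set a := translateAvg f B' w with ha
  have hfabs : ∀ x, |f x| ≤ 1 := fun x => abs_le.2 ⟨by linarith [hf0 x], hf1 x⟩
  have hB'pos : (0 : ℝ) < #B' := by exact_mod_cast hB'.card_pos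
  have hB''pos : (0 : ℝ) < #B'' := by exact_mod_cast card_pos.2 ⟨0, h.1⟩
  have ha1 : a ≤ 1 := translateAvg_le_one hfabs _ _
  have ha0 : 0 ≤ a := div_nonneg (sum_nonneg fun _ _ => hf0 _) hB'pos.le
  let g : G → ℝ := fun x => f (w + x) - a
  have hg : ∀ x, |g x| ≤ 1 := fun x =>
    abs_le.2 ⟨by simp only [g]; linarith [hf0 (w + x)], by simp only [g]; linarith [hf1 (w + x)]⟩
  have hu : ∀ u ∈ B'', ‖∑ b ∈ B', (g (b + u) : ℂ) * γ b - ∑ b ∈ B', (g b : ℂ) * γ b‖ ≤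
      (2 * ε + κ / 4) * #B' := by
    intro u hu
    have h1 := h.norm_sum_shift_sub_le hu (g := fun x => (g x : ℂ) * γ x) fun x => by
      rw [norm_mul, AddChar.norm_apply, mul_one, Complex.norm_real]; exact hg x
    have h2 : ‖∑ b ∈ B', (g (b + u) : ℂ) * γ b - ∑ b ∈ B', (g (b + u) : ℂ) * γ (b + u)‖ ≤
        κ / 4 * #B' := by
      rw [← sum_sub_distrib, mul_comm, ← nsmul_eq_mul]
      refine (norm_sum_le _ _).trans (sum_le_card_nsmul _ _ _ fun b _ => ?_)
      rw [← mul_sub, norm_mul, AddChar.map_add_eq_mul, Complex.norm_real,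
        show γ b - γ b * γ u = -(γ b * (γ u - 1)) by ring, norm_neg, norm_mul,
        AddChar.norm_apply, one_mul]
      calc _ ≤ 1 * ‖γ u - 1‖ := mul_le_mul_of_nonneg_right (hg _) (norm_nonneg _)
        _ ≤ _ := by rw [one_mul]; exact hB'' u hu
    calc _ = ‖(∑ b ∈ B', (g (b + u) : ℂ) * γ b - ∑ b ∈ B', (g (b + u) : ℂ) * γ (b + u)) +
          (∑ b ∈ B', (g (b + u) : ℂ) * γ (b + u) - ∑ b ∈ B', (g b : ℂ) * γ b)‖ := by
          congr 1; abel
      _ ≤ _ := norm_add_le _ _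
      _ ≤ _ := by linarith
  let v : G → ℝ := fun b => translateAvg f B'' (w + b) - a
  have hv : ∀ b, #B'' * v b = ∑ u ∈ B'', g (b + u) := by
    intro b
    simp only [v, g]
    rw [mul_sub, card_mul_translateAvg f ⟨0, h.1⟩, sum_sub_distrib, sum_const, nsmul_eq_mul]
    simp only [add_assoc]
  have hvabs : (κ - 2 * ε - κ / 4) * #B' ≤ ∑ b ∈ B', |v b| := by
    have h1 : ‖∑ u ∈ B'', (∑ b ∈ B', (g (b + u) : ℂ) * γ b - ∑ b ∈ B', (g b : ℂ) * γ b)‖ ≤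
        #B'' * ((2 * ε + κ / 4) * #B') := by
      rw [← nsmul_eq_mul]
      exact (norm_sum_le _ _).trans (sum_le_card_nsmul _ _ _ hu)
    rw [sum_sub_distrib, sum_const, nsmul_eq_mul, sum_comm] at h1
    have h2 : ∑ b ∈ B', ∑ u ∈ B'', (g (b + u) : ℂ) * γ b =
        #B'' * ∑ b ∈ B', (v b : ℂ) * γ b := by
      rw [mul_sum]
      refine sum_congr rfl fun b _ => ?_
      rw [← sum_mul, ← mul_assoc]
      congr 1
      exact_mod_cast (hv b).symm
    rw [h2, ← mul_sub, norm_mul, Complex.norm_natCast] at h1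
    have h3 := le_of_mul_le_mul_left h1 hB''pos
    have h4 : ‖∑ b ∈ B', (v b : ℂ) * γ b‖ ≤ ∑ b ∈ B', |v b| := by
      refine (norm_sum_le _ _).trans (sum_le_sum fun b _ => ?_)
      rw [norm_mul, AddChar.norm_apply, mul_one, Complex.norm_real, Real.norm_eq_abs]
    have h5 := norm_sub_norm_le (∑ b ∈ B', (g b : ℂ) * γ b) (∑ b ∈ B', (v b : ℂ) * γ b)
    rw [norm_sub_rev] at h5
    have h6 : κ * #B' ≤ ‖∑ b ∈ B', (g b : ℂ) * γ b‖ := hγ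
    linarith
  have hvsum : -(2 * ε * #B') ≤ ∑ b ∈ B', v b := by
    have h1 := h.sum_translateAvg_ge hfabs w
    rw [← card_mul_translateAvg f hB', ← ha] at h1
    simp only [v]
    rw [sum_sub_distrib, sum_const, nsmul_eq_mul]
    linarith
  obtain ⟨b, -, hb⟩ := exists_le_of_sum_le hB' (f := fun _ => 3 * κ / 4 - 4 * ε)
    (g := fun b => |v b| + v b) (by
      rw [sum_const, nsmul_eq_mul, sum_add_distrib]; linarith)
  refine ⟨w + b, ?_⟩
  have hb' : κ / 4 ≤ v b := by
    rcases le_total 0 (v b) with h0 | h0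
    · rw [abs_of_nonneg h0] at hb; linarith
    · rw [abs_of_nonpos h0] at hb; linarith
  simp only [v] at hb'
  linarith

end Increment

section Bohr

variable {G : Type*} [AddCommGroup G] [Fintype G]

open Classical in
/-- The Bohr set with frequency set `Γ` and width `ρ`. -/
noncomputable def bohrSet (Γ : Finset (AddChar G ℂ)) (ρ : ℝ) : Finset G :=
  univ.filter fun x => ∀ γ ∈ Γ, ‖γ x - 1‖ ≤ ρ

lemma mem_bohrSet {Γ : Finset (AddChar G ℂ)} {ρ : ℝ} {x : G} :
    x ∈ bohrSet Γ ρ ↔ ∀ γ ∈ Γ, ‖γ x - 1‖ ≤ ρ := by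
  simp [bohrSet]

lemma zero_mem_bohrSet (Γ : Finset (AddChar G ℂ)) {ρ : ℝ} (hρ : 0 ≤ ρ) :
    (0 : G) ∈ bohrSet Γ ρ :=
  mem_bohrSet.2 fun γ _ => by simpa using hρ

lemma bohrSet_mono {Γ Γ' : Finset (AddChar G ℂ)} {ρ ρ' : ℝ} (hΓ : Γ ⊆ Γ') (hρ : ρ ≤ ρ') :
    bohrSet Γ' ρ ⊆ bohrSet Γ ρ' := fun _ hx =>
  mem_bohrSet.2 fun γ hγ => (mem_bohrSet.1 hx γ (hΓ hγ)).trans hρ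

lemma bohrSet_add_subset [DecidableEq G] (Γ : Finset (AddChar G ℂ)) (ρ σ : ℝ) :
    bohrSet Γ ρ + bohrSet Γ σ ⊆ bohrSet Γ (ρ + σ) := by
  intro z hz
  obtain ⟨x, hx, y, hy, rfl⟩ := mem_add.1 hz
  refine mem_bohrSet.2 fun γ hγ => ?_
  have h1 := mem_bohrSet.1 hx γ hγ
  have h2 := mem_bohrSet.1 hy γ hγ
  rw [AddChar.map_add_eq_mul,
    show γ x * γ y - 1 = (γ x - 1) + γ x * (γ y - 1) by ring]
  refine (norm_add_le _ _).trans ?_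
  rw [norm_mul, AddChar.norm_apply, one_mul]
  linarith

lemma card_bohrSet_le_mul_card_half (Γ : Finset (AddChar G ℂ)) {ρ : ℝ} (hρ : 0 < ρ) :
    #(bohrSet Γ ρ) ≤ 128 ^ #Γ * #(bohrSet Γ (ρ / 2)) := by
  classical
  let q : ℝ → ℤ := fun s => ⌊s * (4 / ρ)⌋
  have hq : ∀ s, |s| ≤ ρ → q s ∈ Icc (-4 : ℤ) 4 := by
    intro s hs
    obtain ⟨h1, h2⟩ := abs_le.1 hs
    have h3 : (-4 : ℝ) ≤ s * (4 / ρ) := by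
      rw [mul_div_assoc', le_div_iff₀ hρ]; linarith
    have h4 : s * (4 / ρ) ≤ 4 := by
      rw [mul_div_assoc', div_le_iff₀ hρ]; linarith
    rw [mem_Icc]
    refine ⟨Int.le_floor.2 (by exact_mod_cast h3), ?_⟩
    have := (Int.floor_le (s * (4 / ρ))).trans h4
    exact_mod_cast this
  have hqd : ∀ s t, q s = q t → |s - t| ≤ ρ / 4 := by
    intro s t hst
    have := (Int.abs_sub_lt_one_of_floor_eq_floor hst).le
    rw [← sub_mul, abs_mul, abs_of_pos (by positivity : 0 < 4 / ρ), mul_div_assoc',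
      div_le_iff₀ hρ] at this
    linarith
  let F : G → (Γ → ℤ × ℤ) := fun x γ => (q (γ.1 x - 1).re, q (γ.1 x - 1).im)
  let t : Finset (Γ → ℤ × ℤ) := Fintype.piFinset fun _ => Icc (-4) 4 ×ˢ Icc (-4) 4
  have ht : #t ≤ 128 ^ #Γ := by
    simp only [t, Fintype.card_piFinset, card_product, Int.card_Icc, prod_const, card_univ,
      Fintype.card_coe]
    exact Nat.pow_le_pow_left (by decide) _
  have hmaps : ∀ x ∈ bohrSet Γ ρ, F x ∈ t := by
    intro x hx
    simp only [t, F, Fintype.mem_piFinset, mem_product]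
    intro γ
    have h1 := mem_bohrSet.1 hx γ.1 γ.2
    exact ⟨hq _ ((Complex.abs_re_le_norm _).trans h1), hq _ ((Complex.abs_im_le_norm _).trans h1)⟩
  have hfib : ∀ c ∈ t, #{x ∈ bohrSet Γ ρ | F x = c} ≤ #(bohrSet Γ (ρ / 2)) := by
    intro c _
    rcases (filter (fun x => F x = c) (bohrSet Γ ρ)).eq_empty_or_nonempty with h | ⟨y, hy⟩
    · rw [h]; simp
    · refine card_le_card_of_injOn (fun x => x - y) (fun x hx => ?_)
        (fun a _ b _ hab => sub_left_injective hab)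
      have hxy : F x = F y := (mem_filter.1 hx).2.trans (mem_filter.1 hy).2.symm
      refine mem_bohrSet.2 fun γ hγ => ?_
      have h1 := congrFun hxy ⟨γ, hγ⟩
      simp only [F, Prod.mk.injEq] at h1
      have h2 := hqd _ _ h1.1
      have h3 := hqd _ _ h1.2
      have h4 : γ (x - y) - 1 = γ (-y) * ((γ x - 1) - (γ y - 1)) := by
        have : γ y * γ (-y) = 1 := by rw [← AddChar.map_add_eq_mul]; simp
        rw [sub_eq_add_neg x y, AddChar.map_add_eq_mul]
        linear_combination this
      rw [h4, norm_mul, AddChar.norm_apply, one_mul]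
      refine (Complex.norm_le_abs_re_add_abs_im _).trans ?_
      rw [Complex.sub_re, Complex.sub_im]
      linarith
  calc _ ≤ #(bohrSet Γ (ρ / 2)) * #t := card_le_mul_card_image_of_maps_to hmaps _ hfib
    _ ≤ _ := by rw [mul_comm]; exact Nat.mul_le_mul_right _ ht

lemma card_le_pow_mul_card_bohrSet (Γ : Finset (AddChar G ℂ)) (n : ℕ) :
    Fintype.card G ≤ 128 ^ (#Γ * n) * #(bohrSet Γ (2 / 2 ^ n)) := by
  induction n with
  | zero =>
    have : bohrSet Γ (2 / 2 ^ 0) = univ := by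
      refine eq_univ_of_forall fun x => mem_bohrSet.2 fun γ _ => ?_
      refine (norm_sub_le _ _).trans ?_
      rw [AddChar.norm_apply]; norm_num
    rw [this]; simp
  | succ n ih =>
    refine ih.trans ?_
    have := card_bohrSet_le_mul_card_half Γ (ρ := 2 / 2 ^ n) (by positivity)
    rw [div_div, ← pow_succ] at this
    calc _ ≤ 128 ^ (#Γ * n) * (128 ^ #Γ * #(bohrSet Γ (2 / 2 ^ (n + 1)))) :=
          Nat.mul_le_mul_left _ this
      _ = _ := by ring

/-- Near every width there is one at which the Bohr set is almost invariant. -/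
lemma exists_almostInvariant_bohrSet [DecidableEq G] (Γ : Finset (AddChar G ℂ)) {ρ : ℝ}
    (hρ : 0 < ρ) {d E J : ℕ} (hE : 0 < E) (hd : #Γ ≤ d) (hJ : 7 * d * E ≤ J) (hJ0 : 0 < J) :
    ∃ ρ', ρ / 2 ≤ ρ' ∧ ρ' ≤ ρ ∧
      AlmostInvariant (1 / E) (bohrSet Γ ρ') (bohrSet Γ (ρ / (2 * J))) := by
  have hJ' : (0 : ℝ) < J := by exact_mod_cast hJ0
  have hE' : (0 : ℝ) < E := by exact_mod_cast hE
  let s : ℕ → ℝ := fun j => ρ / 2 + j * (ρ / (2 * J))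
  have hs : ∀ j, s (j + 1) = s j + ρ / (2 * J) := fun j => by simp only [s]; push_cast; ring
  have hsJ : s J = ρ := by simp only [s]; field_simp; ring
  obtain ⟨j, hj, hreg⟩ : ∃ j < J, (#(bohrSet Γ (s (j + 1))) : ℝ) ≤
      (1 + 1 / E) * #(bohrSet Γ (s j)) := by
    by_contra! hcon
    have hind : ∀ j ≤ J, (1 + 1 / (E : ℝ)) ^ j * #(bohrSet Γ (s 0)) ≤ #(bohrSet Γ (s j)) := by
      intro j
      induction j with
      | zero => simp
      | succ j ih =>
        intro hj
        refine le_trans ?_ (hcon j hj).le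
        rw [pow_succ', mul_assoc]
        exact mul_le_mul_of_nonneg_left (ih (by omega)) (by positivity)
    have h2 : (2 : ℝ) ≤ (1 + 1 / (E : ℝ)) ^ E := by
      have := one_add_mul_le_pow (a := 1 / (E : ℝ)) (by
        have : 0 ≤ 1 / (E : ℝ) := by positivity
        linarith) E
      rw [mul_one_div_cancel hE'.ne'] at this
      linarith
    have h3 : (128 : ℝ) ^ #Γ ≤ (1 + 1 / (E : ℝ)) ^ J := by
      have h1 : (1 : ℝ) ≤ 1 + 1 / E := by
        have : 0 ≤ 1 / (E : ℝ) := by positivity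
        linarith
      calc (128 : ℝ) ^ #Γ ≤ 128 ^ d := pow_le_pow_right₀ (by norm_num) hd
        _ = 2 ^ (7 * d) := by rw [pow_mul]; norm_num
        _ ≤ ((1 + 1 / (E : ℝ)) ^ E) ^ (7 * d) := by gcongr
        _ = (1 + 1 / (E : ℝ)) ^ (7 * d * E) := by rw [← pow_mul, mul_comm]
        _ ≤ _ := pow_le_pow_right₀ h1 hJ
    have hb : (0 : ℝ) < #(bohrSet Γ (ρ / 2)) := by
      exact_mod_cast card_pos.2 ⟨0, zero_mem_bohrSet Γ (by positivity)⟩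
    have h4 : (#(bohrSet Γ ρ) : ℝ) ≤ 128 ^ #Γ * #(bohrSet Γ (ρ / 2)) := by
      exact_mod_cast card_bohrSet_le_mul_card_half Γ hρ
    obtain ⟨k, rfl⟩ : ∃ k, J = k + 1 := ⟨J - 1, by omega⟩
    have h5 := hcon k (by omega)
    have h6 := hind k (by omega)
    have hs0 : s 0 = ρ / 2 := by simp [s]
    rw [hsJ] at h5
    rw [hs0] at h6
    have h7 : (1 + 1 / (E : ℝ)) ^ (k + 1) * #(bohrSet Γ (ρ / 2)) < #(bohrSet Γ ρ) := by
      refine lt_of_le_of_lt ?_ h5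
      rw [pow_succ', mul_assoc]
      exact mul_le_mul_of_nonneg_left h6 (by positivity)
    have h8 : (128 : ℝ) ^ #Γ * #(bohrSet Γ (ρ / 2)) ≤
        (1 + 1 / (E : ℝ)) ^ (k + 1) * #(bohrSet Γ (ρ / 2)) := by gcongr
    linarith
  refine ⟨s j, ?_, ?_, zero_mem_bohrSet Γ (by positivity), ?_⟩
  · have : 0 ≤ j * (ρ / (2 * J)) := by positivity
    simp only [s]; linarith
  · rw [← hsJ]
    simp only [s]
    gcongr
  · refine le_trans ?_ hreg
    rw [hs]
    exact_mod_cast card_le_card (bohrSet_add_subset Γ _ _)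

end Bohr

lemma sixtyfour_mul_sq_le {α κ R : ℝ} (hR : 2 ≤ R) (hκ : κ * (128 * R ^ 3) = 1)
    (hα : 1 ≤ α * (4 * R)) : 64 * κ ^ 2 ≤ α ^ 4 * (1 / R) := by
  have hRpos : 0 < R := by linarith
  have h1 : (1 : ℝ) ≤ (α * (4 * R)) ^ 4 := one_le_pow₀ hα
  have h2 : κ ^ 2 * (128 ^ 2 * R ^ 6) = 1 := by
    calc _ = (κ * (128 * R ^ 3)) ^ 2 := by ring
      _ = 1 := by rw [hκ]; norm_num
  rw [mul_one_div, le_div_iff₀ hRpos]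
  have h3 : 64 * κ ^ 2 * R * (256 * R ^ 4) ≤ α ^ 4 * (256 * R ^ 4) := by
    have h4 : 0 ≤ κ ^ 2 * R ^ 5 := by positivity
    have h5 : κ ^ 2 * R ^ 5 * 2 ≤ κ ^ 2 * R ^ 5 * R := mul_le_mul_of_nonneg_left hR h4
    calc 64 * κ ^ 2 * R * (256 * R ^ 4) = 128 ^ 2 * (κ ^ 2 * R ^ 5) := by ring
      _ ≤ 128 ^ 2 * (κ ^ 2 * R ^ 5 * R) := by linarith
      _ = 1 := by rw [← h2]; ring
      _ ≤ _ := h1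
      _ = _ := by ring
  exact le_of_mul_le_mul_right h3 (by positivity)

section Iteration

variable {G : Type*} [AddCommGroup G] [Fintype G] [DecidableEq G]

set_option maxHeartbeats 1000000 in
/-- One step of the density increment iteration: passing to a narrower Bohr set with one more
frequency, the total of the maximal local densities of the colour classes increases. -/
lemma exists_total_density_increment {r : ℕ} (hr : 0 < r) {φ : AddMonoid.End G}
    (hφ : Function.Injective φ) {A : Fin r → Finset G} (hA : ∀ x ≠ 0, ∃ i, x ∈ A i)
    (hfree : ∀ i, ∀ x ∈ A i, ∀ y ∈ A i, ∀ z ∈ A i, x + φ z ≠ y)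
    {f : Fin r → G → ℝ} (hf : ∀ i x, f i x = if x ∈ A i then 1 else 0)
    {κ : ℝ} (hκ : κ * (128 * (2 * r) ^ 3) = 1) {d E J : ℕ} (hE : 0 < E)
    (hEκ : 1 / (E : ℝ) * (64 * (2 * r)) ≤ κ) (hJE : E ≤ J) (hJ : 7 * d * E ≤ J)
    {Γ : Finset (AddChar G ℂ)} (hΓ : #Γ ≤ d) {ρ δ : ℝ} (hρ : 0 ≤ ρ) (hδ : 0 < δ) (hδ1 : δ ≤ 1)
    (hinv : AlmostInvariant (1 / E) (bohrSet Γ ρ) (bohrSet Γ δ))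
    (hbig : 2 ≤ #(bohrSet Γ (δ / 4))) {m : Fin r → ℝ}
    (hm : ∀ j, ∃ x, m j ≤ translateAvg (f j) (bohrSet Γ ρ) x) :
    ∃ γ : AddChar G ℂ, ∀ Γ' : Finset (AddChar G ℂ), Γ ⊆ Γ' → γ ∈ Γ' →
      (∀ γ' ∈ Γ, γ'.compAddMonoidHom φ ∈ Γ') → #Γ' ≤ d →
      ∃ ρ' ≥ 0, ∃ m' : Fin r → ℝ,
        AlmostInvariant (1 / E) (bohrSet Γ' ρ') (bohrSet Γ' (δ / (16 * (J : ℝ) ^ 3))) ∧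
        (∀ j, ∃ x, m' j ≤ translateAvg (f j) (bohrSet Γ' ρ') x) ∧
        ∑ j, m j + κ / 64 ≤ ∑ j, m' j := by
  have hf0 : ∀ i x, 0 ≤ f i x := fun i x => by rw [hf]; split_ifs <;> simp
  have hf1 : ∀ i x, f i x ≤ 1 := fun i x => by rw [hf]; split_ifs <;> simp
  have hfabs : ∀ i x, |f i x| ≤ 1 := fun i x => abs_le.2 ⟨by linarith [hf0 i x], hf1 i x⟩
  set R : ℝ := 2 * r with hR
  have hr1 : (1 : ℝ) ≤ r := by exact_mod_cast hr
  have hR2 : 2 ≤ R := by linarith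
  have hRpos : 0 < R := by linarith
  have hκpos : 0 < κ := by
    by_contra! h
    have : κ * (128 * R ^ 3) ≤ 0 := mul_nonpos_of_nonpos_of_nonneg h (by positivity)
    linarith
  have hJ0 : 0 < J := hE.trans_le hJE
  have hE' : (0 : ℝ) < E := by exact_mod_cast hE
  have hJ' : (0 : ℝ) < J := by exact_mod_cast hJ0
  have hJ1 : (1 : ℝ) ≤ J := by exact_mod_cast hJ0
  set ε : ℝ := 1 / E with hε
  have hεpos : 0 < ε := by positivity
  have hε128 : 128 * ε ≤ κ := by nlinarith
  have hκR : κ * (128 * R) ≤ 1 / 4 := by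
    have h1 : κ * (128 * R) * 4 ≤ κ * (128 * R) * R ^ 2 :=
      mul_le_mul_of_nonneg_left (by nlinarith) (by positivity)
    have h2 : κ * (128 * R) * R ^ 2 = 1 := by rw [← hκ]; ring
    linarith
  have hκ1 : κ ≤ 1 := by nlinarith
  have hε1 : ε ≤ 1 := by linarith
  set δ₁ : ℝ := δ / 2 / (2 * J) with hδ₁
  set δ₂ : ℝ := δ₁ / (2 * J) with hδ₂
  have hδ₁pos : 0 < δ₁ := by positivity
  have hδ₂pos : 0 < δ₂ := by positivity
  have hδ₁le : δ₁ ≤ δ / 2 := div_le_self (by positivity) (by linarith)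
  have hδ₂le : δ₂ ≤ δ₁ := div_le_self (by positivity) (by linarith)
  have hδ₂κ : δ₂ ≤ κ / 4 := by
    have h1 : 1 / (J : ℝ) ≤ ε := one_div_le_one_div_of_le hE' (by exact_mod_cast hJE)
    have h2 : δ₁ ≤ 1 / J := by
      rw [hδ₁, div_le_div_iff₀ (by positivity) hJ']
      nlinarith
    linarith
  have hδ₃ : δ₂ / (2 * J) = δ / (16 * (J : ℝ) ^ 3) := by
    rw [hδ₂, hδ₁]; field_simp; norm_num
  obtain ⟨ρ₁, hρ₁, hρ₁', hinv₁⟩ := exists_almostInvariant_bohrSet Γ (ρ := δ / 2)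
    (by positivity) hE hΓ hJ hJ0
  obtain ⟨ρ₂, hρ₂, hρ₂', hinv₂⟩ := exists_almostInvariant_bohrSet Γ hδ₁pos hE hΓ hJ hJ0
  have hρ₁pos : 0 < ρ₁ := by linarith
  have hρ₂pos : 0 < ρ₂ := by linarith
  set B := bohrSet Γ ρ₁ with hB
  set B' := bohrSet Γ ρ₂ with hB'
  have hB0 : (0 : G) ∈ B := zero_mem_bohrSet _ hρ₁pos.le
  have hB'0 : (0 : G) ∈ B' := zero_mem_bohrSet _ hρ₂pos.le
  have hB2 : 2 ≤ #B := hbig.trans (card_le_card (bohrSet_mono subset_rfl (by linarith)))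
  have hB2' : (2 : ℝ) ≤ #B := by exact_mod_cast hB2
  have hφs : Function.Surjective φ := Finite.surjective_of_injective hφ
  let X₀ : Finset G := univ.filter fun x => φ x ∈ B
  have hX₀im : X₀.image φ = B := by
    ext y
    simp only [X₀, mem_image, mem_filter, mem_univ, true_and]
    refine ⟨?_, fun hy => ?_⟩
    · rintro ⟨x, hx, rfl⟩; exact hx
    · obtain ⟨x, rfl⟩ := hφs y
      exact ⟨x, hy, rfl⟩
  have hX₀card : #X₀ = #B := by rw [← hX₀im, card_image_of_injective _ hφ]
  have hX₀0 : (0 : G) ∈ X₀ := by simpa [X₀] using hB0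
  obtain ⟨i, hi⟩ : ∃ i, (1 / R) * #B ≤ #(X₀ ∩ A i) := by
    have h1 : X₀.erase 0 ⊆ univ.biUnion fun i => X₀ ∩ A i := by
      intro x hx
      obtain ⟨i, hi⟩ := hA x (ne_of_mem_erase hx)
      exact mem_biUnion.2 ⟨i, mem_univ _, mem_inter.2 ⟨mem_of_mem_erase hx, hi⟩⟩
    have h2 := (card_le_card h1).trans card_biUnion_le
    rw [card_erase_of_mem hX₀0, hX₀card] at h2
    have h3 : (#B : ℝ) ≤ ∑ i, (#(X₀ ∩ A i) : ℝ) + 1 := by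
      have : #B ≤ ∑ i, #(X₀ ∩ A i) + 1 := by omega
      exact_mod_cast this
    have : Nonempty (Fin r) := ⟨⟨0, hr⟩⟩
    obtain ⟨i, -, hi⟩ := exists_le_of_sum_le (univ_nonempty (α := Fin r))
      (f := fun _ => (1 / R) * #B) (g := fun i => (#(X₀ ∩ A i) : ℝ)) (by
        rw [sum_const, card_univ, Fintype.card_fin, nsmul_eq_mul]
        have : (r : ℝ) * (1 / R * #B) = #B / 2 := by rw [hR]; field_simp
        linarith)
    exact ⟨i, hi⟩
  suffices hsuff : ∃ γ : AddChar G ℂ, ∀ Γ' : Finset (AddChar G ℂ), Γ ⊆ Γ' → γ ∈ Γ' →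
      (∀ γ' ∈ Γ, γ'.compAddMonoidHom φ ∈ Γ') → ∀ ρ', 0 ≤ ρ' → ρ' ≤ δ₂ →
        ∃ x, m i + κ / 32 ≤ translateAvg (f i) (bohrSet Γ' ρ') x by
    obtain ⟨γ, hγ⟩ := hsuff
    refine ⟨γ, fun Γ' hΓΓ' hγΓ' hφΓ' hΓ' => ?_⟩
    obtain ⟨ρ₃, hρ₃, hρ₃', hinv₃⟩ := exists_almostInvariant_bohrSet Γ' hδ₂pos hE hΓ' hJ hJ0
    have hρ₃0 : 0 ≤ ρ₃ := by linarith
    refine ⟨ρ₃, hρ₃0, fun j => if j = i then m i + κ / 32 else m j - 2 * ε,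
      by rwa [← hδ₃], fun j => ?_, ?_⟩
    · by_cases hj : j = i
      · subst hj
        simpa using hγ Γ' hΓΓ' hγΓ' hφΓ' ρ₃ hρ₃0 hρ₃'
      · obtain ⟨x, hx⟩ := hm j
        obtain ⟨y, hy⟩ := (hinv.mono (bohrSet_mono hΓΓ' (by linarith : ρ₃ ≤ δ))
          (zero_mem_bohrSet _ hρ₃0)).exists_translateAvg_ge ⟨0, zero_mem_bohrSet _ hρ⟩
            (hfabs j) x
        refine ⟨y, ?_⟩
        simp only [hj, if_false]
        linarith
    · have h1 : ∀ j, m j - 2 * ε + (if j = i then κ / 32 else 0) ≤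
          if j = i then m i + κ / 32 else m j - 2 * ε := by
        intro j
        split_ifs with hj
        · subst hj; linarith
        · linarith
      refine le_trans ?_ (sum_le_sum fun j _ => h1 j)
      rw [sum_add_distrib, sum_sub_distrib, sum_const, card_univ, Fintype.card_fin,
        nsmul_eq_mul, sum_ite_eq' univ i]
      simp only [mem_univ, if_true]
      have : (r : ℝ) * (2 * ε) = ε * R := by rw [hR]; ring
      linarith
  by_cases hmi : m i < 1 / (4 * R)
  · refine ⟨0, fun Γ' hΓΓ' _ hφΓ' ρ' hρ'0 hρ' => ?_⟩
    have hX₀inv : AlmostInvariant ε X₀ (bohrSet Γ' ρ') := by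
      refine ⟨zero_mem_bohrSet _ hρ'0, ?_⟩
      have h1 : (X₀ + bohrSet Γ' ρ').image φ ⊆ B + bohrSet Γ δ₁ := by
        intro y hy
        obtain ⟨z, hz, rfl⟩ := mem_image.1 hy
        obtain ⟨x, hx, u, hu, rfl⟩ := mem_add.1 hz
        rw [map_add]
        refine add_mem_add (mem_filter.1 hx).2 (mem_bohrSet.2 fun γ hγ => ?_)
        have := mem_bohrSet.1 hu _ (hφΓ' γ hγ)
        change ‖γ (φ u) - 1‖ ≤ ρ' at this
        exact this.trans (hρ'.trans hδ₂le)
      have h2 := card_le_card h1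
      rw [card_image_of_injective _ hφ] at h2
      rw [hX₀card]
      exact (Nat.cast_le.2 h2).trans hinv₁.2
    obtain ⟨y, hy⟩ := hX₀inv.exists_translateAvg_ge ⟨0, hX₀0⟩ (hfabs i) 0
    refine ⟨y, ?_⟩
    have h3 : 1 / R ≤ translateAvg (f i) X₀ 0 := by
      rw [translateAvg, le_div_iff₀ (by rw [hX₀card]; linarith), hX₀card]
      refine hi.trans (le_of_eq ?_)
      simp only [zero_add, hf, sum_boole, filter_mem_eq_inter]
    have h4 : 1 / (4 * R) + κ ≤ 1 / R - κ := by
      have h5 : κ ≤ 1 / R / 4 := by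
        rw [div_div, le_div_iff₀ (by positivity)]
        nlinarith
      have h6 : 1 / (4 * R) = 1 / R / 4 := by rw [div_div, mul_comm]
      have h7 : 0 < 1 / R := by positivity
      linarith
    linarith
  push Not at hmi
  by_cases hinc : ∃ x, m i + κ / 16 < translateAvg (f i) B' x
  · obtain ⟨x, hx⟩ := hinc
    refine ⟨0, fun Γ' hΓΓ' _ _ ρ' hρ'0 hρ' => ?_⟩
    obtain ⟨y, hy⟩ := (hinv₂.mono (bohrSet_mono hΓΓ' hρ')
      (zero_mem_bohrSet _ hρ'0)).exists_translateAvg_ge ⟨0, hB'0⟩ (hfabs i) x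
    exact ⟨y, by linarith⟩
  push Not at hinc
  obtain ⟨x₀, hx₀⟩ := hm i
  have hmpos : 0 < m i := lt_of_lt_of_le (by positivity) hmi
  have hmR : 1 ≤ m i * (4 * R) := by rwa [div_le_iff₀ (by positivity)] at hmi
  have hεm : 4 * ε + κ / 16 ≤ m i / 2 := by
    have h1 : κ ≤ m i := by
      refine le_of_mul_le_mul_right ?_ (by positivity : 0 < 4 * R)
      linarith
    linarith
  obtain ⟨w, hw, γ, hγ⟩ := exists_addChar_bias (A := A i) (B₀ := bohrSet Γ ρ) (B := B)
    (B' := B') (T := (X₀ ∩ A i).image φ) (f := f i) (hf i) (α := m i) (τ := 1 / R) (ε := ε)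
    (η := κ / 16) (κ := κ) hmpos (by positivity)
    (sixtyfour_mul_sq_le hR2 hκ hmR)
    hεm
    ⟨0, zero_mem_bohrSet _ hρ⟩
    (hinv.mono ((bohrSet_add_subset Γ _ _).trans (bohrSet_mono subset_rfl (by linarith)))
      (by simpa using add_mem_add hB0 hB'0))
    (by
      have h1 := hinv₁.mono (bohrSet_mono subset_rfl hρ₂') hB'0
      refine ⟨h1.1, h1.2.trans ?_⟩
      have : ε ≤ 1 := hε1
      gcongr)
    (by rw [← hX₀im]; exact image_subset_image inter_subset_left)
    hB0 (by rwa [card_image_of_injective _ hφ])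
    (by
      intro t ht a ha hat
      obtain ⟨z, hz, rfl⟩ := mem_image.1 ht
      exact hfree i a ha _ hat z (mem_inter.1 hz).2 rfl)
    hx₀ hinc
  refine ⟨γ, fun Γ' hΓΓ' hγΓ' _ ρ' hρ'0 hρ' => ?_⟩
  obtain ⟨s, hs⟩ := exists_translateAvg_increment (hf0 i) (hf1 i) (ε := ε) (κ := κ)
    (by linarith) hκpos ⟨0, hB'0⟩
    (hinv₂.mono (bohrSet_mono hΓΓ' hρ') (zero_mem_bohrSet _ hρ'0)) hγ
    (fun u hu => (mem_bohrSet.1 hu γ hγΓ').trans (hρ'.trans hδ₂κ))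
  exact ⟨s, by linarith⟩

end Iteration

section Conclusion

variable {G : Type*} [AddCommGroup G]

open Classical in
/-- The characters `γ ∘ φ ^ j` with `γ ∈ F` and `j ≤ n`. -/
noncomputable def charOrbit (φ : AddMonoid.End G) (F : Finset (AddChar G ℂ)) (n : ℕ) :
    Finset (AddChar G ℂ) :=
  (F ×ˢ range (n + 1)).image fun a => a.1.compAddMonoidHom (φ ^ a.2)

lemma card_charOrbit_le (φ : AddMonoid.End G) (F : Finset (AddChar G ℂ)) (n : ℕ) :
    #(charOrbit φ F n) ≤ #F * (n + 1) :=
  card_image_le.trans (by simp)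

lemma mem_charOrbit {φ : AddMonoid.End G} {F : Finset (AddChar G ℂ)} {n : ℕ}
    {ψ : AddChar G ℂ} : ψ ∈ charOrbit φ F n ↔
      ∃ γ ∈ F, ∃ j ≤ n, γ.compAddMonoidHom (φ ^ j) = ψ := by
  simp only [charOrbit, mem_image, mem_product, mem_range, Prod.exists, Nat.lt_succ_iff]
  constructor
  · rintro ⟨γ, j, ⟨hγ, hj⟩, h⟩; exact ⟨γ, hγ, j, hj, h⟩
  · rintro ⟨γ, hγ, j, hj, h⟩; exact ⟨γ, j, ⟨hγ, hj⟩, h⟩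

variable [Fintype G]

/-- If every small Bohr set is nontrivial, then a colouring of the nonzero elements of `G` has a
monochromatic solution of `x + φ z = y`. -/
lemma exists_monochromatic_of_bohrSet_large [DecidableEq G] {r : ℕ} (hr : 0 < r)
    {φ : AddMonoid.End G} (hφ : Function.Injective φ) {A : Fin r → Finset G}
    (hA : ∀ x ≠ 0, ∃ i, x ∈ A i) {κ : ℝ} (hκ : κ * (128 * (2 * r) ^ 3) = 1) {d E J S : ℕ}
    (hE : 0 < E) (hEκ : 1 / (E : ℝ) * (64 * (2 * r)) ≤ κ) (hJE : E ≤ J) (hJ : 7 * d * E ≤ J)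
    (hS : S * (S + 1) ≤ d) (hSκ : (r : ℝ) < S * (κ / 64))
    (hbig : ∀ Γ : Finset (AddChar G ℂ), #Γ ≤ d →
      2 ≤ #(bohrSet Γ (1 / (16 * (J : ℝ) ^ 3) ^ S / 4))) :
    ∃ i, ∃ x ∈ A i, ∃ y ∈ A i, ∃ z ∈ A i, x + φ z = y := by
  by_contra! hfree
  set f : Fin r → G → ℝ := fun i x => if x ∈ A i then 1 else 0 with hf
  have hfabs : ∀ i x, |f i x| ≤ 1 := fun i x => by simp only [hf]; split_ifs <;> simp
  have hJ1 : (1 : ℝ) ≤ J := by exact_mod_cast hE.trans_le hJE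
  set Q : ℝ := 16 * (J : ℝ) ^ 3 with hQ
  have hQ1 : 1 ≤ Q := by
    have : (1 : ℝ) ≤ (J : ℝ) ^ 3 := one_le_pow₀ hJ1
    linarith
  have hQpos : 0 < Q := by linarith
  have hcard : ∀ (F : Finset (AddChar G ℂ)) (k : ℕ), k ≤ S → #F ≤ k →
      #(charOrbit φ F k) ≤ d := fun F k hk hF =>
    (card_charOrbit_le φ F k).trans
      ((Nat.mul_le_mul (hF.trans hk) (by omega)).trans hS)
  have hstate : ∀ k ≤ S, ∃ F : Finset (AddChar G ℂ), #F ≤ k ∧ ∃ ρ ≥ 0, ∃ m : Fin r → ℝ,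
      AlmostInvariant (1 / E) (bohrSet (charOrbit φ F k) ρ)
        (bohrSet (charOrbit φ F k) (1 / Q ^ k)) ∧
      (∀ j, ∃ x, m j ≤ translateAvg (f j) (bohrSet (charOrbit φ F k) ρ) x) ∧
      k * (κ / 64) ≤ ∑ j, m j := by
    intro k
    induction k with
    | zero =>
      intro _
      have huniv : ∀ ρ, bohrSet (charOrbit φ ∅ 0) ρ = (univ : Finset G) := fun ρ =>
        eq_univ_of_forall fun x => mem_bohrSet.2 fun γ hγ => by simp [charOrbit] at hγ
      refine ⟨∅, by simp, 1, zero_le_one, fun _ => 0, ⟨zero_mem_bohrSet _ (by simp), ?_⟩,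
        fun j => ⟨0, ?_⟩, by simp⟩
      · rw [huniv, huniv]
        have h1 : (#((univ : Finset G) + univ) : ℝ) ≤ #(univ : Finset G) := by
          exact_mod_cast card_le_univ _
        have h2 : 0 ≤ 1 / (E : ℝ) * #(univ : Finset G) := by positivity
        linarith
      · refine div_nonneg (sum_nonneg fun b _ => ?_) (by positivity)
        simp only [hf]; split_ifs <;> simp
    | succ k ih =>
      intro hk
      obtain ⟨F, hF, ρ, hρ, m, hinv, hm, hsum⟩ := ih (by omega)
      have hQk : 1 ≤ Q ^ k := one_le_pow₀ hQ1
      have hΓ := hcard F k (by omega) hF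
      obtain ⟨γ, hγ⟩ := exists_total_density_increment hr hφ hA
        (fun i x hx y hy z hz => hfree i x hx y hy z hz) (fun _ _ => rfl) hκ hE hEκ hJE hJ hΓ hρ
        (by positivity) (div_le_one_of_le₀ hQk (by positivity)) hinv
        ((hbig _ hΓ).trans (card_le_card (bohrSet_mono subset_rfl (by
          have : Q ^ k ≤ Q ^ S := pow_le_pow_right₀ hQ1 (by omega)
          gcongr)))) hm
      classical
      have hF' : #(insert γ F) ≤ k + 1 := (card_insert_le _ _).trans (by omega)
      obtain ⟨ρ', hρ', m', hinv', hm', hsum'⟩ := hγ (charOrbit φ (insert γ F) (k + 1))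
        (fun ψ hψ => by
          obtain ⟨γ', hγ', j, hj, rfl⟩ := mem_charOrbit.1 hψ
          exact mem_charOrbit.2 ⟨γ', mem_insert_of_mem hγ', j, by omega, rfl⟩)
        (mem_charOrbit.2 ⟨γ, mem_insert_self _ _, 0, by omega, by ext; rfl⟩)
        (fun ψ hψ => by
          obtain ⟨γ', hγ', j, hj, rfl⟩ := mem_charOrbit.1 hψ
          refine mem_charOrbit.2 ⟨γ', mem_insert_of_mem hγ', j + 1, by omega, ?_⟩
          rw [pow_succ]
          rfl)
        (hcard _ _ hk hF')
      refine ⟨insert γ F, hF', ρ', hρ', m', ?_, hm', ?_⟩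
      · rw [pow_succ, ← div_div]
        exact hinv'
      · push_cast
        linarith
  obtain ⟨F, -, ρ, -, m, -, hm, hsum⟩ := hstate S le_rfl
  have hle : ∑ j, m j ≤ r := by
    calc ∑ j, m j ≤ ∑ _j : Fin r, (1 : ℝ) := sum_le_sum fun j _ => by
          obtain ⟨x, hx⟩ := hm j
          exact hx.trans (translateAvg_le_one (hfabs j) _ _)
      _ = r := by simp
  linarith

/-- A finite abelian group whose nonzero elements are coloured with `r` colours without
monochromatic solutions of `x + φ z = y` has size at most exponential in a power of `r`. -/
lemma card_le_of_no_monochromatic [DecidableEq G] {r : ℕ} (hr : 0 < r)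
    {φ : AddMonoid.End G} (hφ : Function.Injective φ) {A : Fin r → Finset G}
    (hA : ∀ x ≠ 0, ∃ i, x ∈ A i)
    (hfree : ¬ ∃ i, ∃ x ∈ A i, ∃ y ∈ A i, ∃ z ∈ A i, x + φ z = y) :
    Fintype.card G ≤ 2 ^ (2 * r) ^ 65 := by
  by_contra! hlarge
  obtain ⟨R, hR⟩ : ∃ R, R = 2 * r := ⟨_, rfl⟩
  rw [← hR] at hlarge
  have hR2 : 2 ≤ R := by omega
  have hRpow : ∀ k, 2 ^ k ≤ R ^ k := fun k => Nat.pow_le_pow_left hR2 k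
  have hR2' : (2 : ℝ) ≤ R := by exact_mod_cast hR2
  have hRr : (2 * r : ℝ) = R := by rw [hR]; push_cast; ring
  have hRpos : (0 : ℝ) < R := by linarith
  refine hfree (exists_monochromatic_of_bohrSet_large hr hφ hA (κ := 1 / (128 * (R : ℝ) ^ 3))
    (d := R ^ 35) (E := R ^ 17) (J := R ^ 55) (S := R ^ 17) ?_ (by positivity) ?_ ?_ ?_ ?_ ?_ ?_)
  · rw [hRr]; field_simp
  · rw [hRr]
    push_cast
    rw [one_div_mul_eq_div, div_le_div_iff₀ (by positivity) (by positivity)]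
    calc 64 * (R : ℝ) * (128 * (R : ℝ) ^ 3) = 2 ^ 13 * (R : ℝ) ^ 4 := by ring
      _ ≤ (R : ℝ) ^ 13 * (R : ℝ) ^ 4 := by gcongr
      _ = 1 * (R : ℝ) ^ 17 := by ring
  · exact Nat.pow_le_pow_right (by omega) (by norm_num)
  · calc 7 * R ^ 35 * R ^ 17 = 7 * R ^ 52 := by ring
      _ ≤ R ^ 3 * R ^ 52 := by gcongr; exact le_trans (by norm_num) (hRpow 3)
      _ = _ := by ring
  · calc R ^ 17 * (R ^ 17 + 1) ≤ R ^ 17 * (R ^ 17 + R ^ 17) := by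
          gcongr; exact Nat.one_le_pow _ _ (by omega)
      _ = 2 * R ^ 34 := by ring
      _ ≤ R * R ^ 34 := by gcongr
      _ = _ := by ring
  · have h1 : (r : ℝ) < R := by
      have : r < R := by omega
      exact_mod_cast this
    refine h1.trans_le ?_
    push_cast
    rw [div_div, mul_one_div, le_div_iff₀ (by positivity)]
    calc (R : ℝ) * (128 * (R : ℝ) ^ 3 * 64) = 2 ^ 13 * (R : ℝ) ^ 4 := by ring
      _ ≤ (R : ℝ) ^ 13 * (R : ℝ) ^ 4 := by gcongr
      _ = (R : ℝ) ^ 17 := by ring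
  · intro Γ hΓ
    set n := 3 + 169 * R ^ 18 with hn
    have h1 := card_le_pow_mul_card_bohrSet Γ n
    have hwidth : (2 : ℝ) / 2 ^ n ≤ 1 / (16 * ((R ^ 55 : ℕ) : ℝ) ^ 3) ^ (R ^ 17) / 4 := by
      have h2 : (16 * ((R ^ 55 : ℕ) : ℝ) ^ 3) ^ (R ^ 17) ≤ 2 ^ (169 * R ^ 18) := by
        have h3 : 16 * ((R ^ 55 : ℕ) : ℝ) ^ 3 ≤ (R : ℝ) ^ 169 := by
          push_cast
          calc 16 * ((R : ℝ) ^ 55) ^ 3 = 2 ^ 4 * (R : ℝ) ^ 165 := by ring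
            _ ≤ R ^ 4 * (R : ℝ) ^ 165 := by gcongr
            _ = _ := by ring
        have h4 : (R : ℝ) ≤ 2 ^ R := by exact_mod_cast Nat.lt_two_pow_self.le
        calc _ ≤ ((R : ℝ) ^ 169) ^ (R ^ 17) := by gcongr
          _ ≤ ((2 ^ R) ^ 169) ^ (R ^ 17) := by gcongr
          _ = _ := by rw [← pow_mul, ← pow_mul]; congr 1; ring
      rw [div_div, div_le_div_iff₀ (by positivity) (by positivity), hn, pow_add]
      linarith
    have h5 : 128 ^ (#Γ * n) ≤ 2 ^ R ^ 65 := by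
      calc 128 ^ (#Γ * n) = 2 ^ (7 * (#Γ * n)) := by rw [pow_mul 2 7]; norm_num
        _ ≤ _ := by
          refine Nat.pow_le_pow_right (by norm_num) ?_
          have h6 : n ≤ R ^ 27 := by
            have h7 : 1 ≤ R ^ 18 := Nat.one_le_pow _ _ (by omega)
            calc n ≤ 2 ^ 9 * R ^ 18 := by omega
              _ ≤ R ^ 9 * R ^ 18 := by gcongr
              _ = _ := by ring
          calc 7 * (#Γ * n) ≤ R ^ 3 * (R ^ 35 * R ^ 27) := by
                gcongr; exact le_trans (by norm_num) (hRpow 3)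
            _ = _ := by ring
    have h8 : 2 ≤ #(bohrSet Γ (2 / 2 ^ n)) := by
      by_contra! h
      have h9 : 128 ^ (#Γ * n) * #(bohrSet Γ (2 / 2 ^ n)) ≤ 2 ^ R ^ 65 * 1 :=
        Nat.mul_le_mul h5 (by omega)
      omega
    exact h8.trans (card_le_card (bohrSet_mono subset_rfl hwidth))

end Conclusion

/-- A one-row system satisfying the columns condition either has constant solutions or has among
its solutions those built from `x + c z = y`. -/
lemma ColumnsCondition.exists_solution_of_add_mul_eq {m : ℕ} {K : Type*} [Field K]
    {A : Matrix (Fin 1) (Fin m) K} (hA : ColumnsCondition A) :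
    ∃ c : K, c ≠ 0 ∧ ∀ x y z : K, x + c * z = y →
      ∃ v : Fin m → K, A.mulVec v = 0 ∧ ((∀ i, v i = x) ∨
        ∀ i, v i = x ∨ v i = y ∨ v i = z) := by
  classical
  obtain ⟨d, P, -, hP⟩ := hA
  by_cases hz : ∀ i, A 0 i = 0
  · refine ⟨1, one_ne_zero, fun x y z _ => ⟨fun _ => x, ?_, Or.inl fun _ => rfl⟩⟩
    ext k
    obtain rfl : k = 0 := Subsingleton.elim _ _
    simp [Matrix.mulVec, dotProduct, hz]
  push Not at hz
  obtain ⟨i₀, hi₀, hmin⟩ := exists_min_image (univ.filter fun i => A 0 i ≠ 0) P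
    (by obtain ⟨i, hi⟩ := hz; exact ⟨i, by simpa using hi⟩)
  replace hi₀ : A 0 i₀ ≠ 0 := by simpa using hi₀
  have hzero : ∀ i, P i < P i₀ → A 0 i = 0 := by
    intro i hi
    by_contra h
    exact absurd (hmin i (by simpa using h)) (not_le.2 hi)
  have hsum : ∑ i ∈ univ.filter (fun i => P i = P i₀), A 0 i = 0 := by
    have h1 := hP (P i₀)
    have h2 : Submodule.span K {c : Fin 1 → K | ∃ i : Fin m, P i < P i₀ ∧ c = fun k => A k i} =
        ⊥ := by
      rw [Submodule.span_eq_bot]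
      rintro c ⟨i, hi, rfl⟩
      ext k
      obtain rfl : k = 0 := Subsingleton.elim _ _
      exact hzero i hi
    rw [h2, Submodule.mem_bot] at h1
    have := congrFun h1 0
    simpa [Finset.sum_apply] using this
  set a := A 0 i₀ with ha
  set b := ∑ i ∈ univ.filter (fun i => ¬ P i = P i₀), A 0 i with hb
  by_cases hb0 : b = 0
  · refine ⟨1, one_ne_zero, fun x y z _ => ⟨fun _ => x, ?_, Or.inl fun _ => rfl⟩⟩
    ext k
    obtain rfl : k = 0 := Subsingleton.elim _ _
    simp only [Matrix.mulVec, dotProduct, Pi.zero_apply]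
    rw [← sum_mul, ← sum_filter_add_sum_filter_not univ (fun i => P i = P i₀), hsum, ← hb, hb0]
    simp
  · refine ⟨-(b / a), neg_ne_zero.2 (div_ne_zero hb0 hi₀), fun x y z hxyz =>
      ⟨fun i => if P i = P i₀ then (if i = i₀ then y - x else 0) + x else z, ?_, Or.inr ?_⟩⟩
    · ext k
      obtain rfl : k = 0 := Subsingleton.elim _ _
      simp only [Matrix.mulVec, dotProduct, Pi.zero_apply]
      rw [← sum_filter_add_sum_filter_not univ (fun i => P i = P i₀)]
      have h1 : ∑ i ∈ univ.filter (fun i => P i = P i₀),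
          A 0 i * (if P i = P i₀ then (if i = i₀ then y - x else 0) + x else z) =
            a * (y - x) := by
        rw [sum_congr rfl (g := fun i => A 0 i * (if i = i₀ then y - x else 0) + A 0 i * x)
          (fun i hi => by rw [if_pos (mem_filter.1 hi).2, mul_add]),
          sum_add_distrib, ← sum_mul, hsum]
        simp [ha]
      have h2 : ∑ i ∈ univ.filter (fun i => ¬ P i = P i₀),
          A 0 i * (if P i = P i₀ then (if i = i₀ then y - x else 0) + x else z) = b * z := by
        rw [hb, sum_mul]
        exact sum_congr rfl fun i hi => by rw [if_neg (mem_filter.1 hi).2]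
      rw [h1, h2, ← hxyz]
      field_simp
      ring
    · intro i
      dsimp only
      split_ifs <;> simp

/-- There is an absolute constant `C > 0` such that: if `p` is prime, `A` is a `1 × m`
matrix over `ℤ/pℤ` satisfying the columns condition, and `(ℤ/pℤ)*` is `r`-coloured with
no monochromatic solution (in nonzero residues) of `Ax = 0`, then `p ≤ exp((2r)^C)`. -/
theorem one_row_modular_rado_bounded :
    ∃ C : ℝ, 0 < C ∧ ∀ p m r : ℕ, p.Prime → 0 < r →
      ∀ A : Matrix (Fin 1) (Fin m) (ZMod p), ColumnsCondition A →
        ∀ χ : ZMod p → Fin r,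
          (¬ ∃ x : Fin m → ZMod p, (∀ i, x i ≠ 0) ∧ A.mulVec x = 0 ∧
            ∀ i j : Fin m, χ (x i) = χ (x j)) →
          (p : ℝ) ≤ Real.exp ((2 * (r : ℝ)) ^ C) := by
  refine ⟨(65 : ℕ), by norm_num, fun p m r hp hr A hA χ hχ => ?_⟩
  have : Fact p.Prime := ⟨hp⟩
  obtain ⟨c, hc, hsol⟩ := hA.exists_solution_of_add_mul_eq
  have hcard : Fintype.card (ZMod p) ≤ 2 ^ (2 * r) ^ 65 := by
    refine card_le_of_no_monochromatic hr (φ := AddMonoidHom.mulLeft c)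
      (mul_right_injective₀ hc) (A := fun i => univ.filter fun x => x ≠ 0 ∧ χ x = i)
      (fun x hx => ⟨χ x, by simp [hx]⟩) ?_
    rintro ⟨i, x, hx, y, hy, z, hz, hxyz⟩
    simp only [mem_filter, mem_univ, true_and] at hx hy hz
    obtain ⟨v, hv, hv'⟩ := hsol x y z hxyz
    have hvi : ∀ j, v j ≠ 0 ∧ χ (v j) = i := by
      intro j
      rcases hv' with h | h
      · rw [h j]; exact hx
      · rcases h j with h | h | h <;> rw [h] <;> assumption
    exact hχ ⟨v, fun j => (hvi j).1, hv, fun j k => (hvi j).2.trans (hvi k).2.symm⟩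
  rw [ZMod.card] at hcard
  rw [Real.rpow_natCast]
  calc (p : ℝ) ≤ 2 ^ (2 * r) ^ 65 := by exact_mod_cast hcard
    _ ≤ Real.exp 1 ^ (2 * r) ^ 65 := by
      gcongr
      linarith [Real.add_one_le_exp 1]
    _ = _ := by rw [← Real.exp_nat_mul]; push_cast; rw [mul_one]
end

section
/- There is an absolute constant C > 0 such that the following holds. Suppose a, N ∈ ℕ are coprime, and the set (ℤ/Nℤ)* of nonzero elements of ℤ/Nℤ is r-coloured in such a way that there is no triple (x₁, x₂, x₃) of nonzero elements of ℤ/Nℤ, all of the same colour, with a·x₁ + x₂ − x₃ = 0 in ℤ/Nℤ. Then N ≤ exp((2r)^C). -/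
open Finset ZMod

namespace ModularSchur

section Fourier

variable {N : ℕ} [NeZero N]

/-- The exponential sum of a finite set at a frequency. -/
noncomputable def expSum (X : Finset (ZMod N)) (γ : ZMod N) : ℂ :=
  ∑ x ∈ X, stdAddChar (γ * x)

/-- The correlation `∑ v, f v * f (v + z)` with respect to counting measure. -/
noncomputable def corr (f : ZMod N → ℝ) (z : ZMod N) : ℝ := ∑ v, f v * f (v + z)

lemma norm_stdAddChar (x : ZMod N) : ‖stdAddChar x‖ = 1 := by
  rw [stdAddChar_apply]; exact Circle.norm_coe _

lemma norm_stdAddChar_add_sub_one_le (x y : ZMod N) :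
    ‖stdAddChar (x + y) - 1‖ ≤ ‖stdAddChar x - 1‖ + ‖stdAddChar y - 1‖ := by
  have h : stdAddChar (x + y) - 1 =
      (stdAddChar x - 1) * stdAddChar y + (stdAddChar y - 1) := by
    rw [AddChar.map_add_eq_mul]; ring
  rw [h]
  refine (norm_add_le _ _).trans ?_
  rw [norm_mul, norm_stdAddChar, mul_one]

lemma norm_stdAddChar_neg_sub_one (x : ZMod N) :
    ‖stdAddChar (-x) - 1‖ = ‖stdAddChar x - 1‖ := by
  have h : stdAddChar x - 1 = -(stdAddChar x * (stdAddChar (-x) - 1)) := by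
    rw [mul_sub, ← AddChar.map_add_eq_mul, add_neg_cancel, AddChar.map_zero_eq_one]; ring
  rw [h, norm_neg, norm_mul, norm_stdAddChar, one_mul]

lemma norm_stdAddChar_sub_one_le_two (x : ZMod N) : ‖stdAddChar x - 1‖ ≤ 2 := by
  refine (norm_sub_le _ _).trans ?_
  rw [norm_stdAddChar, norm_one]; norm_num

lemma conj_stdAddChar (x : ZMod N) : (starRingEnd ℂ) (stdAddChar x) = stdAddChar (-x) := by
  rw [AddChar.map_neg_eq_conj]

lemma norm_expSum_le (X : Finset (ZMod N)) (γ : ZMod N) : ‖expSum X γ‖ ≤ #X := by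
  refine (norm_sum_le _ _).trans ?_
  simp

lemma card_mul_corr (f : ZMod N → ℝ) (z : ZMod N) :
    (N : ℂ) * (corr f z : ℂ) =
      ∑ γ : ZMod N, ((‖∑ v, (f v : ℂ) * stdAddChar (γ * v)‖ ^ 2 : ℝ) : ℂ) * stdAddChar (γ * z) := by
  have h1 : ∀ γ : ZMod N,
      ((‖∑ v, (f v : ℂ) * stdAddChar (γ * v)‖ ^ 2 : ℝ) : ℂ) * stdAddChar (γ * z) =
      ∑ v, ∑ u, (f v : ℂ) * f u * stdAddChar (γ * (v + z - u)) := by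
    intro γ
    push_cast
    rw [← Complex.mul_conj', map_sum, sum_mul_sum, sum_mul]
    refine sum_congr rfl fun v _ => ?_
    rw [sum_mul]
    refine sum_congr rfl fun u _ => ?_
    rw [map_mul (starRingEnd ℂ), Complex.conj_ofReal, conj_stdAddChar,
      show γ * (v + z - u) = γ * v + -(γ * u) + γ * z by ring,
      AddChar.map_add_eq_mul, AddChar.map_add_eq_mul]
    ring
  simp_rw [h1]
  rw [sum_comm, corr]
  push_cast
  rw [mul_sum]
  refine sum_congr rfl fun v _ => ?_
  rw [sum_comm]
  simp_rw [← mul_sum, AddChar.sum_mulShift _ (isPrimitive_stdAddChar N)]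
  rw [sum_eq_single (v + z)]
  · simp [ZMod.card]; ring
  · intro u _ hu
    rw [if_neg (by rwa [sub_eq_zero, eq_comm])]; simp
  · simp

lemma sum_norm_sq_transform (f : ZMod N → ℝ) :
    ∑ γ : ZMod N, ‖∑ v, (f v : ℂ) * stdAddChar (γ * v)‖ ^ 2 = N * corr f 0 := by
  have h := card_mul_corr f 0
  simp only [mul_zero, AddChar.map_zero_eq_one, mul_one] at h
  exact_mod_cast h.symm

/-- Shifting by an element that is annihilated by the large spectrum of `X` barely changes the
average of an autocorrelation over `X`. -/
lemma abs_sum_corr_shift_sub_le (f : ZMod N → ℝ) (X : Finset (ZMod N)) (w : ZMod N) (b : ℝ)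
    (h : ∀ γ, ‖expSum X γ‖ * ‖stdAddChar (γ * w) - 1‖ ≤ b) :
    |∑ x ∈ X, corr f (x + w) - ∑ x ∈ X, corr f x| ≤ b * corr f 0 := by
  have hN : (0 : ℝ) < N := Nat.cast_pos.2 (NeZero.pos N)
  set F : ZMod N → ℝ := fun γ => ‖∑ v, (f v : ℂ) * stdAddChar (γ * v)‖ ^ 2 with hF
  have key : (N : ℂ) * ((∑ x ∈ X, corr f (x + w) - ∑ x ∈ X, corr f x : ℝ) : ℂ) =
      ∑ γ, (F γ : ℂ) * (expSum X γ * (stdAddChar (γ * w) - 1)) := by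
    push_cast
    rw [← sum_sub_distrib, mul_sum]
    simp_rw [mul_sub (N : ℂ), card_mul_corr, expSum, sum_mul, mul_sum]
    rw [sum_comm]
    refine sum_congr rfl fun x _ => ?_
    rw [← sum_sub_distrib]
    refine sum_congr rfl fun γ _ => ?_
    rw [mul_add γ x w, AddChar.map_add_eq_mul]
    ring
  have h2 : N * |∑ x ∈ X, corr f (x + w) - ∑ x ∈ X, corr f x| ≤ b * (N * corr f 0) := by
    rw [← sum_norm_sq_transform, mul_sum]
    have := congrArg norm key
    rw [norm_mul, Complex.norm_natCast, Complex.norm_real, Real.norm_eq_abs] at this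
    rw [this]
    refine (norm_sum_le _ _).trans (sum_le_sum fun γ _ => ?_)
    rw [norm_mul, norm_mul, Complex.norm_real, Real.norm_of_nonneg (by positivity), mul_comm b]
    exact mul_le_mul_of_nonneg_left (h γ) (by positivity)
  have h3 : N * |∑ x ∈ X, corr f (x + w) - ∑ x ∈ X, corr f x| ≤ N * (b * corr f 0) := by
    linarith
  exact le_of_mul_le_mul_left h3 hN

/-- A set of frequencies in the large spectrum of `X ⊆ P` that is separated with respect to `P`
is small. -/
lemma card_separated_spectrum_le {P X Λ : Finset (ZMod N)} {η ε : ℝ} (hη : 0 < η) (hε : 0 < ε)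
    (hP : P.Nonempty) (hXP : X ⊆ P) (hX : ε * #P ≤ #X)
    (hΛ : ∀ γ ∈ Λ, η * #X ≤ ‖expSum X γ‖)
    (hsep : ∀ γ ∈ Λ, ∀ γ' ∈ Λ, γ ≠ γ' → ‖expSum P (γ - γ')‖ ≤ η ^ 2 * ε / 2 * #P) :
    (#Λ : ℝ) ≤ 2 / (η ^ 2 * ε) := by
  have hPpos : (0 : ℝ) < #P := by exact_mod_cast hP.card_pos
  have hXpos : (0 : ℝ) < #X := lt_of_lt_of_le (by positivity) hX
  -- unimodular multipliers
  have hc : ∀ z : ℂ, ∃ c : ℂ, ‖c‖ ≤ 1 ∧ c * z = ‖z‖ := by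
    intro z
    by_cases hz : z = 0
    · exact ⟨0, by simp, by simp [hz]⟩
    · refine ⟨(starRingEnd ℂ) z / ‖z‖, ?_, ?_⟩
      · simp [hz]
      · have : (‖z‖ : ℂ) ≠ 0 := by simpa using hz
        field_simp
        rw [mul_comm, Complex.mul_conj']
  choose c hc1 hc2 using hc
  set g : ZMod N → ℂ := fun x => ∑ γ ∈ Λ, c (expSum X γ) * stdAddChar (γ * x) with hg
  have h1 : ∑ γ ∈ Λ, ‖expSum X γ‖ ≤ ∑ x ∈ X, ‖g x‖ := by
    have : ((∑ γ ∈ Λ, ‖expSum X γ‖ : ℝ) : ℂ) = ∑ x ∈ X, g x := by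
      push_cast
      rw [hg, sum_comm]
      refine sum_congr rfl fun γ _ => ?_
      rw [← hc2 (expSum X γ), ← mul_sum, expSum]
    have h' := congrArg norm this
    rw [Complex.norm_real, Real.norm_of_nonneg (by positivity)] at h'
    rw [h']; exact norm_sum_le _ _
  have h2 : ∑ x ∈ P, ‖g x‖ ^ 2 ≤ #Λ * #P + #Λ ^ 2 * (η ^ 2 * ε / 2 * #P) := by
    have e1 : ((∑ x ∈ P, ‖g x‖ ^ 2 : ℝ) : ℂ) = ∑ γ ∈ Λ, ∑ γ' ∈ Λ,
        c (expSum X γ) * (starRingEnd ℂ) (c (expSum X γ')) * expSum P (γ - γ') := by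
      push_cast
      simp_rw [← Complex.mul_conj', hg, map_sum, sum_mul_sum, expSum, mul_sum]
      rw [sum_comm]
      refine sum_congr rfl fun γ _ => ?_
      rw [sum_comm]
      refine sum_congr rfl fun γ' _ => sum_congr rfl fun x _ => ?_
      rw [map_mul (starRingEnd ℂ), conj_stdAddChar, sub_mul, sub_eq_add_neg, AddChar.map_add_eq_mul]
      ring
    have e2 := congrArg norm e1
    rw [Complex.norm_real, Real.norm_of_nonneg (by positivity)] at e2
    rw [e2]
    have e3 : ∀ γ ∈ Λ, ∀ γ' ∈ Λ,
        ‖c (expSum X γ) * (starRingEnd ℂ) (c (expSum X γ')) * expSum P (γ - γ')‖ ≤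
          (if γ = γ' then (#P : ℝ) else 0) + η ^ 2 * ε / 2 * #P := by
      intro γ hγ γ' hγ'
      rw [norm_mul, norm_mul, RCLike.norm_conj]
      have hle : ‖c (expSum X γ)‖ * ‖c (expSum X γ')‖ ≤ 1 :=
        mul_le_one₀ (hc1 _) (norm_nonneg _) (hc1 _)
      refine (mul_le_of_le_one_left (norm_nonneg _) hle).trans ?_
      split_ifs with h
      · have := norm_expSum_le P (γ - γ')
        have : 0 ≤ η ^ 2 * ε / 2 * #P := by positivity
        linarith
      · rw [zero_add]; exact hsep γ hγ γ' hγ' h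
    refine (norm_sum_le _ _).trans ((sum_le_sum fun γ hγ => (norm_sum_le _ _).trans
      (sum_le_sum fun γ' hγ' => e3 γ hγ γ' hγ')).trans ?_)
    simp only [sum_add_distrib, sum_const, nsmul_eq_mul, sum_ite_eq]
    rw [sum_ite_mem, inter_self, sum_const, nsmul_eq_mul]
    apply le_of_eq; ring
  have h3 : (∑ x ∈ X, ‖g x‖) ^ 2 ≤ #X * ∑ x ∈ P, ‖g x‖ ^ 2 := by
    refine (sq_sum_le_card_mul_sum_sq).trans ?_
    gcongr
  have h4 : #Λ * (η * #X) ≤ ∑ γ ∈ Λ, ‖expSum X γ‖ := by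
    rw [← nsmul_eq_mul]; exact card_nsmul_le_sum _ _ _ hΛ
  have h5 : (#Λ * (η * #X)) ^ 2 ≤ #X * (#Λ * #P + #Λ ^ 2 * (η ^ 2 * ε / 2 * #P)) := by
    calc ((#Λ : ℝ) * (η * #X)) ^ 2 ≤ (∑ x ∈ X, ‖g x‖) ^ 2 := by
          gcongr; exact h4.trans h1
      _ ≤ _ := h3.trans (by gcongr)
  rw [le_div_iff₀ (by positivity)]
  by_contra hlt
  push Not at hlt
  have hk : (0 : ℝ) < #Λ := by
    rcases Nat.eq_zero_or_pos (#Λ) with h0 | h0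
    · rw [h0] at hlt; norm_num at hlt
    · exact_mod_cast h0
  have h6 : #Λ * η ^ 2 * #X ≤ #P + #Λ * (η ^ 2 * ε / 2 * #P) := by
    have : (#Λ * #X : ℝ) * (#Λ * η ^ 2 * #X) ≤
        (#Λ * #X : ℝ) * (#P + #Λ * (η ^ 2 * ε / 2 * #P)) := by nlinarith
    exact le_of_mul_le_mul_left this (by positivity)
  have h7 : #Λ * η ^ 2 * (ε * #P) ≤ #Λ * η ^ 2 * #X := by gcongr
  nlinarith

/-- The large spectrum of a dense subset `X` of `P` is covered by few translates of the large
spectrum of `P`. -/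
lemma exists_cover_spectrum {P X : Finset (ZMod N)} {η ε : ℝ} (hη : 0 < η) (hε : 0 < ε)
    (hP : P.Nonempty) (hXP : X ⊆ P) (hX : ε * #P ≤ #X) :
    ∃ Λ : Finset (ZMod N), (#Λ : ℝ) ≤ 2 / (η ^ 2 * ε) ∧
      ∀ γ, η * #X ≤ ‖expSum X γ‖ → ∃ l ∈ Λ, η ^ 2 * ε / 2 * #P ≤ ‖expSum P (γ - l)‖ := by
  classical
  let good : Finset (ZMod N) → Prop := fun Λ => (∀ γ ∈ Λ, η * #X ≤ ‖expSum X γ‖) ∧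
    ∀ γ ∈ Λ, ∀ γ' ∈ Λ, γ ≠ γ' → ‖expSum P (γ - γ')‖ ≤ η ^ 2 * ε / 2 * #P
  obtain ⟨Λ, hΛ, hmax⟩ := Finset.exists_max_image (univ.filter good) card
    ⟨∅, by simp [good]⟩
  rw [mem_filter] at hΛ
  refine ⟨Λ, card_separated_spectrum_le hη hε hP hXP hX hΛ.2.1 hΛ.2.2, ?_⟩
  intro γ hγ
  by_contra! hcon
  have hPpos : (0 : ℝ) < #P := by exact_mod_cast hP.card_pos
  have hsymm : ∀ δ : ZMod N, ‖expSum P (-δ)‖ = ‖expSum P δ‖ := by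
    intro δ
    rw [← RCLike.norm_conj (expSum P δ), expSum, expSum, map_sum]
    simp_rw [conj_stdAddChar, neg_mul]
  by_cases hmem : γ ∈ Λ
  · have h := hcon γ hmem
    have hX1 : (#X : ℝ) ≤ #P := by exact_mod_cast card_le_card hXP
    have hXpos : (0 : ℝ) < #X := lt_of_lt_of_le (by positivity) hX
    rw [sub_self, expSum] at h
    simp only [zero_mul, AddChar.map_zero_eq_one, sum_const, nsmul_eq_mul, mul_one,
      Complex.norm_natCast] at h
    have hη1 : η ≤ 1 := by
      have := hγ.trans (norm_expSum_le X γ)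
      exact le_of_mul_le_mul_right (by linarith) hXpos
    have hε1 : ε ≤ 1 := le_of_mul_le_mul_right (by linarith) hPpos
    have : η ^ 2 * ε ≤ 1 := mul_le_one₀ (pow_le_one₀ hη.le hη1) hε.le hε1
    nlinarith
  · have hins : good (insert γ Λ) := by
      refine ⟨?_, ?_⟩
      · intro δ hδ
        rcases mem_insert.1 hδ with rfl | h
        · exact hγ
        · exact hΛ.2.1 δ h
      · intro δ hδ δ' hδ' hne
        rcases mem_insert.1 hδ with rfl | h <;> rcases mem_insert.1 hδ' with rfl | h'
        · exact absurd rfl hne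
        · exact (hcon δ' h').le
        · rw [← neg_sub, hsymm]; exact (hcon δ h).le
        · exact hΛ.2.2 δ h δ' h' hne
    have := hmax (insert γ Λ) (by simpa using hins)
    rw [card_insert_of_notMem hmem] at this
    omega

/-- A frequency at which a nearly shift-invariant set has a large exponential sum is nearly trivial
on the shift. -/
lemma norm_stdAddChar_sub_one_mul_norm_expSum_le {P P' : Finset (ZMod N)} {c : ℝ} {w : ZMod N}
    (hPP' : P ⊆ P') (hw : ∀ p ∈ P, p + w ∈ P') (hcard : (#P' : ℝ) ≤ (1 + c) * #P) (l : ZMod N) :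
    ‖stdAddChar (l * w) - 1‖ * ‖expSum P l‖ ≤ 2 * c * #P := by
  classical
  set Pw := P.image (· + w) with hPw
  have hinj : Function.Injective (fun x : ZMod N => x + w) := add_left_injective w
  have hPwP' : Pw ⊆ P' := by
    intro x hx
    obtain ⟨p, hp, rfl⟩ := mem_image.1 hx
    exact hw p hp
  have hPwcard : #Pw = #P := card_image_of_injective _ hinj
  have e1 : (stdAddChar (l * w) - 1) * expSum P l = expSum Pw l - expSum P l := by
    rw [hPw, expSum, expSum, sum_image (fun _ _ _ _ h => hinj h), sub_mul, one_mul, mul_sum]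
    congr 1
    refine sum_congr rfl fun x _ => ?_
    rw [mul_add, AddChar.map_add_eq_mul]; ring
  have e2 : expSum Pw l - expSum P l = (expSum P' l - expSum P l) - (expSum P' l - expSum Pw l) := by
    ring
  have e3 : ∀ R ⊆ P', #R = #P → ‖expSum P' l - expSum R l‖ ≤ c * #P := by
    intro R hR hRc
    have : expSum P' l - expSum R l = expSum (P' \ R) l := by
      rw [expSum, expSum, expSum, ← sum_sdiff hR]; ring
    rw [this]
    refine (norm_expSum_le _ _).trans ?_
    rw [card_sdiff_of_subset hR, Nat.cast_sub (card_le_card hR), hRc]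
    linarith
  rw [← norm_mul, e1, e2]
  refine (norm_sub_le _ _).trans ?_
  have := e3 P hPP' rfl
  have := e3 Pw hPwP' hPwcard
  linarith

end Fourier

section Density

variable {N : ℕ}

/-- `A` has density at least `q` on some translate of every nonempty subset of `U`. -/
def TransDense (A U : Finset (ZMod N)) (q : ℝ) : Prop :=
  ∀ S ⊆ U, S.Nonempty → ∃ x, q * #S ≤ #{s ∈ S | x + s ∈ A}

lemma TransDense.mono {A U V : Finset (ZMod N)} {q : ℝ} (h : TransDense A U q) (hV : V ⊆ U) :
    TransDense A V q := fun S hS hne => h S (hS.trans hV) hne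

lemma TransDense.le_one {A U : Finset (ZMod N)} {q : ℝ} (h : TransDense A U q)
    (hU : U.Nonempty) : q ≤ 1 := by
  obtain ⟨x, hx⟩ := h U Subset.rfl hU
  have hpos : (0 : ℝ) < #U := by exact_mod_cast hU.card_pos
  have h2 : (#{s ∈ U | x + s ∈ A} : ℝ) ≤ #U := by exact_mod_cast card_filter_le _ _
  exact le_of_mul_le_mul_right (by linarith) hpos

/-- The correlations of an indicator smoothed by `T` are the correlations of its local counts. -/
lemma sum_sum_corr_eq [NeZero N] (f : ZMod N → ℝ) (T : Finset (ZMod N)) (x : ZMod N) :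
    ∑ s ∈ T, ∑ t ∈ T, corr f (x + (t - s)) =
      ∑ y, (∑ t ∈ T, f (y + t)) * ∑ t ∈ T, f (y + x + t) := by
  simp_rw [sum_mul_sum, corr]
  rw [sum_comm (s := univ)]
  refine sum_congr rfl fun s _ => ?_
  rw [sum_comm (s := univ)]
  refine sum_congr rfl fun t _ => ?_
  rw [← Equiv.sum_comp (Equiv.addRight s)]
  refine sum_congr rfl fun y _ => ?_
  simp only [Equiv.coe_addRight]
  congr 2
  ring

/-- If `A` has density `q` on a translate of the nearly invariant set `S`, has density at most
`1.01 * q` on every translate of `T`, and `T` is annihilated by the large spectrum of `X`, then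
some element of `X` is a difference of two elements of `A`. -/
lemma exists_sub_mem_of_dense [NeZero N] {A S S' T X : Finset (ZMod N)} {q η : ℝ} {x₀ : ZMod N}
    (hq : 0 < q) (hη : η ≤ q / 4) (hT : T.Nonempty) (hS : S.Nonempty) (hX : X.Nonempty)
    (hTA : ∀ y, (#{t ∈ T | y + t ∈ A} : ℝ) ≤ 101 / 100 * q * #T)
    (hSA : q * #S ≤ #{s ∈ S | x₀ + s ∈ A})
    (hSS' : (#S' : ℝ) ≤ 101 / 100 * #S)
    (hS1 : ∀ s ∈ S, ∀ t ∈ T, s - t ∈ S')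
    (hS2 : ∀ s ∈ S, ∀ t ∈ T, ∀ x ∈ X, s - t - x ∈ S')
    (hspec : ∀ s ∈ T, ∀ t ∈ T, ∀ γ,
      ‖expSum X γ‖ * ‖stdAddChar (γ * (t - s)) - 1‖ ≤ 2 * η * #X) :
    ∃ x ∈ X, ∃ u ∈ A, ∃ v ∈ A, u - v = x := by
  classical
  by_contra! hcon
  set A' : Finset (ZMod N) := {s ∈ S | x₀ + s ∈ A} with hA'
  set f : ZMod N → ℝ := fun v => if v ∈ A' then 1 else 0 with hf
  have hf0 : corr f 0 = #A' := by simp [corr, hf]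
  have hfX : ∀ x ∈ X, corr f x = 0 := by
    intro x hx
    refine sum_eq_zero fun v _ => ?_
    by_cases h1 : v ∈ A'
    · by_cases h2 : v + x ∈ A'
      · rw [hA', mem_filter] at h1 h2
        exact absurd (by ring) (hcon x hx _ h2.2 _ h1.2)
      · simp [hf, h2]
    · simp [hf, h1]
  have hTpos : (0 : ℝ) < #T := by exact_mod_cast hT.card_pos
  have hSpos : (0 : ℝ) < #S := by exact_mod_cast hS.card_pos
  have hXpos : (0 : ℝ) < #X := by exact_mod_cast hX.card_pos
  set G : ZMod N → ℝ := fun y => ∑ t ∈ T, f (y + t) with hG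
  set Q : ℝ := 101 / 100 * q * #T with hQ
  have hQpos : 0 < Q := by positivity
  have hGle : ∀ y, G y ≤ Q := by
    intro y
    refine le_trans ?_ (hTA (x₀ + y))
    rw [hG]
    simp only [hf, sum_boole]
    norm_cast
    refine card_le_card fun t ht => ?_
    rw [mem_filter] at ht ⊢
    rw [hA', mem_filter] at ht
    exact ⟨ht.1, by rw [add_assoc]; exact ht.2.2⟩
  have hG0 : ∀ y, G y ≠ 0 → ∃ s ∈ S, ∃ t ∈ T, y = s - t := by
    intro y hy
    obtain ⟨t, ht, hne⟩ := exists_ne_zero_of_sum_ne_zero hy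
    have : y + t ∈ A' := by
      by_contra h
      exact hne (by simp [hf, h])
    exact ⟨y + t, (mem_filter.1 this).1, t, ht, by ring⟩
  have hGsum : ∑ y, G y = #A' * #T := by
    rw [hG, sum_comm]
    have : ∀ t ∈ T, ∑ y, f (y + t) = #A' := by
      intro t _
      refine (Equiv.sum_comp (Equiv.addRight t) f).trans ?_
      simp [hf]
    rw [sum_congr rfl this, sum_const, nsmul_eq_mul]; ring
  have hlow : ∀ x ∈ X, 2 * Q * (#A' * #T) - Q ^ 2 * #S' ≤ ∑ y, G y * G (y + x) := by
    intro x hx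
    have e1 : ∑ y ∈ S', G y = #A' * #T := by
      rw [← hGsum]
      refine sum_subset (subset_univ _) fun y _ hy => ?_
      by_contra h
      obtain ⟨s, hs, t, ht, rfl⟩ := hG0 y h
      exact hy (hS1 s hs t ht)
    have e2 : ∑ y ∈ S', G (y + x) = #A' * #T := by
      rw [← hGsum, ← Equiv.sum_comp (Equiv.addRight x) G]
      refine sum_subset (subset_univ _) fun y _ hy => ?_
      by_contra h
      obtain ⟨s, hs, t, ht, he⟩ := hG0 _ h
      exact hy (by rw [show y = s - t - x by rw [← he]; simp]; exact hS2 s hs t ht x hx)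
    have hGnn : ∀ y, 0 ≤ G y := fun y => sum_nonneg fun t _ => by
      simp only [hf]; split_ifs <;> norm_num
    calc 2 * Q * (#A' * #T) - Q ^ 2 * #S'
        = ∑ y ∈ S', (Q * G y + Q * G (y + x) - Q ^ 2) := by
          rw [sum_sub_distrib, sum_add_distrib, ← mul_sum, ← mul_sum, e1, e2, sum_const,
            nsmul_eq_mul]; ring
      _ ≤ ∑ y ∈ S', G y * G (y + x) := sum_le_sum fun y _ => by
          nlinarith [mul_nonneg (sub_nonneg.2 (hGle y)) (sub_nonneg.2 (hGle (y + x)))]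
      _ ≤ ∑ y, G y * G (y + x) :=
          sum_le_sum_of_subset_of_nonneg (subset_univ _) fun y _ _ =>
            mul_nonneg (hGnn _) (hGnn _)
  have hup : ∑ x ∈ X, ∑ y, G y * G (y + x) ≤ #T * (#T * (2 * η * #X * #A')) := by
    have e : ∑ x ∈ X, ∑ y, G y * G (y + x) =
        ∑ s ∈ T, ∑ t ∈ T, ∑ x ∈ X, corr f (x + (t - s)) := by
      simp_rw [hG, ← sum_sum_corr_eq]
      rw [sum_comm]
      exact sum_congr rfl fun s _ => sum_comm
    rw [e, ← nsmul_eq_mul]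
    refine sum_le_card_nsmul _ _ _ fun s hs => ?_
    rw [← nsmul_eq_mul]
    refine sum_le_card_nsmul _ _ _ fun t ht => ?_
    have h := abs_sum_corr_shift_sub_le f X (t - s) _ (hspec s hs t ht)
    rw [sum_eq_zero hfX, sub_zero, hf0] at h
    exact (le_abs_self _).trans h
  have hlow' : #X * (2 * Q * (#A' * #T) - Q ^ 2 * #S') ≤ ∑ x ∈ X, ∑ y, G y * G (y + x) := by
    rw [← nsmul_eq_mul]
    exact card_nsmul_le_sum _ _ _ hlow
  have hfin := hlow'.trans hup
  have h1 : 2 * Q * (#A' * #T) - Q ^ 2 * #S' ≤ #T * (#T * (2 * η * #A')) := by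
    refine le_of_mul_le_mul_left ?_ hXpos
    linarith
  have h2 : 2 * (101 / 100 * q) * #A' - (101 / 100 * q) ^ 2 * #S' ≤ 2 * η * #A' := by
    refine le_of_mul_le_mul_left ?_ (show (0 : ℝ) < #T * #T by positivity)
    rw [hQ] at h1
    linarith
  have h3 : (101 / 100 * q) ^ 2 * #S' ≤ (101 / 100 * q) ^ 2 * (101 / 100 * #S) := by gcongr
  have h4 : 2 * η * #A' ≤ 2 * (q / 4) * #A' := by gcongr
  have h5 : q * (q * #S) ≤ q * #A' := by gcongr
  have h6 : 0 < q * (q * #S) := by positivity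
  nlinarith

/-- A set that is sparse on all translates of `T` is sparse on every set nearly invariant
under `T`. -/
lemma card_inter_le_of_sparse {A P P' T : Finset (ZMod N)} {q : ℝ} (hT : T.Nonempty)
    (hTA : ∀ y, (#{t ∈ T | y + t ∈ A} : ℝ) ≤ q * #T)
    (hP : ∀ p ∈ P, ∀ t ∈ T, p - t ∈ P') :
    (#{p ∈ P | p ∈ A} : ℝ) ≤ q * #P' := by
  classical
  have hTpos : (0 : ℝ) < #T := by exact_mod_cast hT.card_pos
  have h1 : (∑ y ∈ P', #{t ∈ T | y + t ∈ A} : ℝ) ≤ #P' * (q * #T) := by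
    rw [← nsmul_eq_mul]
    exact sum_le_card_nsmul _ _ _ fun y _ => hTA y
  have h2 : #T * #{p ∈ P | p ∈ A} ≤ ∑ y ∈ P', #{t ∈ T | y + t ∈ A} := by
    simp_rw [card_filter]
    rw [sum_comm, ← smul_eq_mul]
    refine card_nsmul_le_sum _ _ _ fun t ht => ?_
    rw [← card_filter, ← card_filter]
    refine card_le_card_of_injOn (· - t) ?_ ?_
    · intro p hp
      simp only [coe_filter, Set.mem_ofPred_eq] at hp ⊢
      exact ⟨hP p hp.1 t ht, by simpa using hp.2⟩
    · intro p _ p' _ h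
      simpa using h
  have h3 : (#T * #{p ∈ P | p ∈ A} : ℝ) ≤ ∑ y ∈ P', #{t ∈ T | y + t ∈ A} := by
    exact_mod_cast h2
  refine le_of_mul_le_mul_left ?_ hTpos
  push_cast at h1 h3
  linarith

end Density

section Bohr

variable {N : ℕ} [NeZero N]

/-- The Bohr set with frequencies `Γ` and (chordal) radius `ρ`. -/
noncomputable def bohr (Γ : Finset (ZMod N)) (ρ : ℝ) : Finset (ZMod N) :=
  {x | ∀ γ ∈ Γ, ‖stdAddChar (γ * x) - 1‖ ≤ ρ}

lemma mem_bohr {Γ : Finset (ZMod N)} {ρ : ℝ} {x : ZMod N} :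
    x ∈ bohr Γ ρ ↔ ∀ γ ∈ Γ, ‖stdAddChar (γ * x) - 1‖ ≤ ρ := by
  simp [bohr]

lemma zero_mem_bohr (Γ : Finset (ZMod N)) {ρ : ℝ} (hρ : 0 ≤ ρ) : 0 ∈ bohr Γ ρ := by
  simp [mem_bohr, hρ]

lemma bohr_mono {Γ Γ' : Finset (ZMod N)} {ρ ρ' : ℝ} (hΓ : Γ ⊆ Γ') (hρ : ρ' ≤ ρ) :
    bohr Γ' ρ' ⊆ bohr Γ ρ := fun _ hx =>
  mem_bohr.2 fun γ hγ => (mem_bohr.1 hx γ (hΓ hγ)).trans hρ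

lemma add_mem_bohr {Γ : Finset (ZMod N)} {ρ σ : ℝ} {x y : ZMod N} (hx : x ∈ bohr Γ ρ)
    (hy : y ∈ bohr Γ σ) : x + y ∈ bohr Γ (ρ + σ) :=
  mem_bohr.2 fun γ hγ => by
    rw [mul_add]
    exact (norm_stdAddChar_add_sub_one_le _ _).trans
      (add_le_add (mem_bohr.1 hx γ hγ) (mem_bohr.1 hy γ hγ))

lemma neg_mem_bohr {Γ : Finset (ZMod N)} {ρ : ℝ} {x : ZMod N} (hx : x ∈ bohr Γ ρ) :
    -x ∈ bohr Γ ρ :=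
  mem_bohr.2 fun γ hγ => by
    rw [mul_neg, norm_stdAddChar_neg_sub_one]; exact mem_bohr.1 hx γ hγ

lemma sub_mem_bohr {Γ : Finset (ZMod N)} {ρ σ : ℝ} {x y : ZMod N} (hx : x ∈ bohr Γ ρ)
    (hy : y ∈ bohr Γ σ) : x - y ∈ bohr Γ (ρ + σ) := by
  rw [sub_eq_add_neg]; exact add_mem_bohr hx (neg_mem_bohr hy)

lemma norm_stdAddChar_sub_le {M : ℕ} (hM : 0 < M) {u v : ZMod N}
    (h : M * u.val / N = M * v.val / N) : ‖stdAddChar (u - v) - 1‖ ≤ 2 * Real.pi / M := by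
  have hN : 0 < N := NeZero.pos N
  have hNR : (0 : ℝ) < N := by exact_mod_cast hN
  have hMR : (0 : ℝ) < M := by exact_mod_cast hM
  set θ : ℝ := 2 * Real.pi * (((u.val : ℝ) - v.val) / N) with hθ
  have e : stdAddChar (u - v) = Complex.exp (Complex.I * θ) := by
    have : u - v = (((u.val : ℤ) - v.val : ℤ) : ZMod N) := by
      push_cast; simp
    rw [this, stdAddChar_coe, hθ]
    congr 1
    push_cast
    ring
  rw [e]
  refine Real.norm_exp_I_mul_ofReal_sub_one_le.trans ?_
  have hu := Nat.div_add_mod (M * u.val) N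
  have hv := Nat.div_add_mod (M * v.val) N
  have hu' := Nat.mod_lt (M * u.val) hN
  have hv' := Nat.mod_lt (M * v.val) hN
  rw [h] at hu
  have h1 : |(M : ℝ) * ((u.val : ℝ) - v.val)| ≤ N := by
    rw [abs_le]
    have a1 : M * u.val ≤ M * v.val + N := by omega
    have a2 : M * v.val ≤ M * u.val + N := by omega
    have a1' : (M : ℝ) * u.val ≤ M * v.val + N := by exact_mod_cast a1
    have a2' : (M : ℝ) * v.val ≤ M * u.val + N := by exact_mod_cast a2
    constructor <;> linarith
  have h2 : |((u.val : ℝ) - v.val) / N| ≤ 1 / M := by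
    rw [abs_mul, abs_of_pos hMR] at h1
    rw [abs_div, abs_of_pos hNR, div_le_div_iff₀ hNR hMR]
    linarith
  rw [Real.norm_eq_abs, hθ, abs_mul, abs_of_pos Real.two_pi_pos]
  calc 2 * Real.pi * |((u.val : ℝ) - v.val) / N| ≤ 2 * Real.pi * (1 / M) := by gcongr
    _ = _ := by ring

/-- Bohr sets are large. -/
lemma le_pow_mul_card_bohr (Γ : Finset (ZMod N)) {M : ℕ} (hM : 0 < M) {ρ : ℝ}
    (hρ : 2 * Real.pi / M ≤ ρ) : N ≤ M ^ #Γ * #(bohr Γ ρ) := by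
  classical
  have hN : 0 < N := NeZero.pos N
  let cell : ZMod N → (Γ → Fin M) := fun x γ =>
    ⟨M * ((γ : ZMod N) * x).val / N, by
      rw [Nat.div_lt_iff_lt_mul hN]
      exact (Nat.mul_lt_mul_left hM).2 (ZMod.val_lt _)⟩
  have hfib : ∀ c ∈ (univ : Finset (Γ → Fin M)), #{x ∈ (univ : Finset (ZMod N)) | cell x = c} ≤
      #(bohr Γ ρ) := by
    intro c _
    rcases ({x ∈ (univ : Finset (ZMod N)) | cell x = c} : Finset _).eq_empty_or_nonempty
      with h | ⟨x₀, hx₀⟩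
    · rw [h]; simp
    · refine card_le_card_of_injOn (· - x₀) ?_ ?_
      · intro x hx
        simp only [coe_filter, Set.mem_ofPred_eq, mem_filter, mem_univ, true_and] at hx hx₀
        refine mem_bohr.2 fun γ hγ => ?_
        rw [mul_sub]
        refine (norm_stdAddChar_sub_le hM ?_).trans hρ
        have := congrFun (hx.trans hx₀.symm) ⟨γ, hγ⟩
        exact congrArg Fin.val this
      · intro p _ p' _ h
        simpa using h
  have := card_le_mul_card_image_of_maps_to (s := (univ : Finset (ZMod N)))
    (t := (univ : Finset (Γ → Fin M))) (f := cell) (fun _ _ => mem_univ _) _ hfib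
  rw [card_univ, ZMod.card, card_univ, Fintype.card_fun, Fintype.card_fin, Fintype.card_coe] at this
  rw [mul_comm]; exact this

/-- Among `n` consecutive radii, one is regular. -/
lemma exists_regular_radius (Γ : Finset (ZMod N)) {M n : ℕ} (hM : 0 < M) {ρ σ c : ℝ}
    (hρ : 2 * Real.pi / M ≤ ρ) (hσ : 0 ≤ σ) (hc : 0 < c)
    (hn : (M : ℝ) ^ #Γ < (1 + c) ^ n) :
    ∃ ρ', ρ ≤ ρ' ∧ ρ' ≤ ρ + n * σ ∧
      (#(bohr Γ (ρ' + σ)) : ℝ) ≤ (1 + c) * #(bohr Γ ρ') := by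
  by_contra! hcon
  have hstep : ∀ i ≤ n, (1 + c) ^ i * #(bohr Γ ρ) ≤ (#(bohr Γ (ρ + i * σ)) : ℝ) := by
    intro i
    induction i with
    | zero => intro _; simp
    | succ i ih =>
      intro hi
      have h1 := ih (by omega)
      have h2 := hcon (ρ + i * σ) (by simp; positivity) (by
        have : (i : ℝ) ≤ n := by exact_mod_cast (by omega : i ≤ n)
        gcongr)
      rw [show ρ + i * σ + σ = ρ + ((i + 1 : ℕ) : ℝ) * σ by push_cast; ring] at h2
      refine le_trans ?_ h2.le
      rw [pow_succ', mul_assoc]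
      gcongr
  have h1 := hstep n le_rfl
  have h2 : (#(bohr Γ (ρ + n * σ)) : ℝ) ≤ N := by
    have := card_le_univ (bohr Γ (ρ + n * σ))
    rw [ZMod.card] at this
    exact_mod_cast this
  have h3 : (N : ℝ) ≤ (M : ℝ) ^ #Γ * #(bohr Γ ρ) := by
    exact_mod_cast le_pow_mul_card_bohr Γ hM hρ
  have h4 : (0 : ℝ) < #(bohr Γ ρ) := by
    have : (0 : ℝ) < N := by exact_mod_cast NeZero.pos N
    by_contra h
    have : (#(bohr Γ ρ) : ℝ) = 0 := le_antisymm (not_lt.1 h) (by positivity)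
    rw [this] at h3; linarith
  have h5 := mul_lt_mul_of_pos_right hn h4
  linarith

end Bohr

section Orbit

variable {N : ℕ}

/-- The frequencies `a ^ j * l` with `l ∈ Λ` and `j ≤ m`. -/
def orbit (a : ZMod N) (Λ : Finset (ZMod N)) (m : ℕ) : Finset (ZMod N) :=
  (Λ ×ˢ range (m + 1)).image fun p => a ^ p.2 * p.1

lemma card_orbit_le (a : ZMod N) (Λ : Finset (ZMod N)) (m : ℕ) :
    #(orbit a Λ m) ≤ #Λ * (m + 1) := by
  refine card_image_le.trans ?_
  rw [card_product, card_range]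

lemma orbit_mono (a : ZMod N) {Λ Λ' : Finset (ZMod N)} {m m' : ℕ} (hΛ : Λ ⊆ Λ') (hm : m ≤ m') :
    orbit a Λ m ⊆ orbit a Λ' m' :=
  image_subset_image (product_subset_product hΛ (range_mono (by omega)))

lemma subset_orbit (a : ZMod N) (Λ : Finset (ZMod N)) (m : ℕ) : Λ ⊆ orbit a Λ m :=
  fun l hl => mem_image.2 ⟨(l, 0), by simp [hl], by simp⟩

lemma mul_mem_bohr_orbit [NeZero N] {a : ZMod N} {Λ : Finset (ZMod N)} {m : ℕ} {ρ : ℝ} {x : ZMod N}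
    (hx : x ∈ bohr (orbit a Λ (m + 1)) ρ) : a * x ∈ bohr (orbit a Λ m) ρ := by
  refine mem_bohr.2 fun γ hγ => ?_
  obtain ⟨⟨l, j⟩, hlj, rfl⟩ := mem_image.1 hγ
  rw [mem_product, mem_range] at hlj
  have := mem_bohr.1 hx (a ^ (j + 1) * l)
    (mem_image.2 ⟨(l, j + 1), by simp only [mem_product, mem_range]; exact ⟨hlj.1, by omega⟩, rfl⟩)
  convert this using 4
  ring

end Orbit

section Iteration

variable {N : ℕ} [NeZero N]

/-- If `A` is dense on a translate of `S` and a dense subset `X` of `P` avoids `A - A`, then `A` has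
increased density on some translate of any set `T` annihilated by suitable few frequencies. -/
lemma exists_frequencies_density_increment {A S S' P P' X : Finset (ZMod N)} {q η ε c : ℝ}
    {x₀ : ZMod N} (hη : 0 < η) (hε : 0 < ε) (hηq : η ≤ q / 4) (hc : 8 * c ≤ η ^ 3 * ε)
    (hS : S.Nonempty) (hP : P.Nonempty) (hPP' : P ⊆ P') (hXP : X ⊆ P) (hX : ε * #P ≤ #X)
    (hXA : ∀ x ∈ X, ∀ u ∈ A, ∀ v ∈ A, u - v ≠ x)
    (hSA : q * #S ≤ #{s ∈ S | x₀ + s ∈ A})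
    (hSS' : (#S' : ℝ) ≤ 101 / 100 * #S) (hPcard : (#P' : ℝ) ≤ (1 + c) * #P) :
    ∃ Λ : Finset (ZMod N), (#Λ : ℝ) ≤ 2 / (η ^ 2 * ε) ∧
      ∀ T : Finset (ZMod N), T.Nonempty → (∀ t ∈ T, ∀ p ∈ P, p + t ∈ P') →
        (∀ t ∈ T, ∀ s ∈ S, s - t ∈ S') → (∀ t ∈ T, ∀ s ∈ S, ∀ x ∈ P, s - t - x ∈ S') →
        (∀ t ∈ T, ∀ l ∈ Λ, ‖stdAddChar (l * t) - 1‖ ≤ η / 2) →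
        ∃ y, 101 / 100 * q * #T < #{t ∈ T | y + t ∈ A} := by
  obtain ⟨Λ, hΛcard, hΛ⟩ := exists_cover_spectrum hη hε hP hXP hX
  refine ⟨Λ, hΛcard, fun T hT hTP hTS hTSP hTΛ => ?_⟩
  have hPpos : (0 : ℝ) < #P := by exact_mod_cast hP.card_pos
  have hXpos : (0 : ℝ) < #X := lt_of_lt_of_le (by positivity) hX
  have hXne : X.Nonempty := card_pos.1 (by exact_mod_cast hXpos)
  have hann : ∀ t ∈ T, ∀ γ, η * #X ≤ ‖expSum X γ‖ → ‖stdAddChar (γ * t) - 1‖ ≤ η := by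
    intro t ht γ hγ
    obtain ⟨l, hl, hlP⟩ := hΛ γ hγ
    have h1 := norm_stdAddChar_sub_one_mul_norm_expSum_le hPP' (hTP t ht) hPcard (γ - l)
    have h2 : ‖stdAddChar ((γ - l) * t) - 1‖ * (η ^ 2 * ε / 2 * #P) ≤
        η / 2 * (η ^ 2 * ε / 2 * #P) :=
      calc ‖stdAddChar ((γ - l) * t) - 1‖ * (η ^ 2 * ε / 2 * #P)
          ≤ ‖stdAddChar ((γ - l) * t) - 1‖ * ‖expSum P (γ - l)‖ := by gcongr
        _ ≤ 2 * c * #P := h1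
        _ ≤ (η / 2 * (η ^ 2 * ε / 2)) * #P := mul_le_mul_of_nonneg_right (by linarith) hPpos.le
        _ = _ := by ring
    have h3 := le_of_mul_le_mul_right h2 (by positivity)
    have h4 := norm_stdAddChar_add_sub_one_le (l * t) ((γ - l) * t)
    rw [show l * t + (γ - l) * t = γ * t by ring] at h4
    linarith [hTΛ t ht l hl]
  by_contra! hcon
  obtain ⟨x, hx, u, hu, v, hv, huv⟩ := exists_sub_mem_of_dense (by linarith) hηq hT hS hXne hcon hSA
    hSS' (fun s hs t ht => hTS t ht s hs) (fun s hs t ht x hx => hTSP t ht s hs x (hXP hx)) (by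
      intro s hs t ht γ
      by_cases hγ : η * #X ≤ ‖expSum X γ‖
      · have h1 := norm_stdAddChar_add_sub_one_le (γ * t) (-(γ * s))
        rw [norm_stdAddChar_neg_sub_one, show γ * t + -(γ * s) = γ * (t - s) by ring] at h1
        have h2 : ‖stdAddChar (γ * (t - s)) - 1‖ ≤ 2 * η := by
          linarith [hann t ht γ hγ, hann s hs γ hγ]
        calc _ ≤ #X * (2 * η) := by gcongr; exact norm_expSum_le X γ
          _ = _ := by ring
      · calc _ ≤ (η * #X) * 2 := by
              gcongr
              · exact (not_le.1 hγ).le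
              · exact norm_stdAddChar_sub_one_le_two _
          _ = _ := by ring)
  exact hXA x hx u hu v hv huv

/-- The density thresholds of the iteration for `r` colours. -/
noncomputable def level (r : ℕ) : ℕ → ℝ
  | 0 => 0
  | k + 1 => 1 / (4 * r) * (101 / 100) ^ k

lemma le_level_succ {r : ℕ} (k : ℕ) : 1 / (4 * r : ℝ) ≤ level r (k + 1) := by
  rw [level]
  exact le_mul_of_one_le_right (by positivity) (one_le_pow₀ (by norm_num))

lemma le_of_level_le_one {r k : ℕ} (hr : 0 < r) (h : level r k ≤ 1) : k ≤ 401 * r := by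
  rcases k with _ | k
  · omega
  rw [level] at h
  have hrR : (0 : ℝ) < r := by exact_mod_cast hr
  have h1 : (101 / 100 : ℝ) ^ k ≤ 4 * r := by
    rw [one_div, inv_mul_le_iff₀ (by positivity)] at h
    linarith
  have h2 := one_add_mul_le_pow (show (-2 : ℝ) ≤ 1 / 100 by norm_num) k
  norm_num at h2
  have h3 : (k : ℝ) ≤ 400 * r := by linarith
  have h4 : k ≤ 400 * r := by exact_mod_cast h3
  omega

/-- The Bohr set used at scale `m` of the iteration. -/
noncomputable def scaleSet (a : ZMod N) (n : ℕ) (Λ : Finset (ZMod N)) (m : ℕ) : Finset (ZMod N) :=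
  bohr (orbit a Λ m) ((1 / (4 * n : ℝ)) ^ m)

lemma scaleSet_anti (a : ZMod N) {n : ℕ} (hn : 0 < n) {Λ Λ' : Finset (ZMod N)} {m m' : ℕ}
    (hΛ : Λ ⊆ Λ') (hm : m ≤ m') : scaleSet a n Λ' m' ⊆ scaleSet a n Λ m := by
  have hn1 : (1 : ℝ) ≤ n := by exact_mod_cast hn
  refine bohr_mono (orbit_mono a hΛ hm) (pow_le_pow_of_le_one (by positivity) ?_ hm)
  rw [div_le_one (by positivity)]; linarith

/-- A colouring without solutions always admits a density increment on a finer Bohr set. -/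
lemma exists_density_increment {a : ZMod N} (ha : IsUnit a) {r : ℕ} (hr : 0 < r)
    {A : Fin r → Finset (ZMod N)} (hcover : ∀ x, x ≠ 0 → ∃ i, x ∈ A i)
    (hfree : ∀ i, ∀ x ∈ A i, ∀ u ∈ A i, ∀ v ∈ A i, u - v ≠ a * x)
    {Λ : Finset (ZMod N)} {m n : ℕ} (hn : 8 * r ≤ n)
    (hsize : 3 * ((14 * (4 * n) ^ (m + 1) : ℕ) : ℝ) ^ #(orbit a Λ m) ≤
      (1 + 1 / (131072 * (r : ℝ) ^ 4)) ^ n)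
    (hN : (1 + 1 / (131072 * (r : ℝ) ^ 4)) ^ n < N) {k : Fin r → ℕ}
    (hdense : ∀ i, TransDense (A i) (scaleSet a n Λ m) (level r (k i))) :
    ∃ i, ∃ Λ' : Finset (ZMod N), #Λ' ≤ 2048 * r ^ 3 ∧
      TransDense (A i) (scaleSet a n (Λ ∪ Λ') (m + 2)) (level r (k i + 1)) := by
  classical
  by_contra! hterm
  have hrR : (1 : ℝ) ≤ r := by exact_mod_cast hr
  have hnR : 8 * (r : ℝ) ≤ n := by exact_mod_cast hn
  have hn0 : 0 < n := by omega
  have hnpos : (0 : ℝ) < n := by exact_mod_cast hn0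
  set c : ℝ := 1 / (131072 * (r : ℝ) ^ 4) with hc
  have hcpos : 0 < c := by positivity
  have hr4 : (1 : ℝ) ≤ (r : ℝ) ^ 4 := one_le_pow₀ hrR
  have hc1 : c ≤ 1 / 100 := by
    rw [hc]; gcongr; linarith
  set M : ℕ := 14 * (4 * n) ^ (m + 1) with hM
  have hMpos : 0 < M := by positivity
  set Γ := orbit a Λ m with hΓ
  set τ : ℝ := (1 / (4 * n : ℝ)) ^ m with hτ
  set σ : ℝ := (1 / (4 * n : ℝ)) ^ (m + 1) with hσ
  set σ' : ℝ := (1 / (4 * n : ℝ)) ^ (m + 2) with hσ'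
  have hσpos : 0 < σ := by positivity
  have hσ'pos : 0 < σ' := by positivity
  have hτσ : τ = 4 * n * σ := by rw [hσ, pow_succ, ← hτ]; field_simp
  have hσσ' : σ = 4 * n * σ' := by rw [hσ', pow_succ, ← hσ]; field_simp
  have hn1 : (8 : ℝ) ≤ n := by linarith
  have hστ : σ ≤ τ := by rw [hτσ]; nlinarith
  have hσ'σ : 4 * σ' ≤ σ := by rw [hσσ']; nlinarith
  have hτ1 : τ ≤ 1 := pow_le_one₀ (by positivity) (by rw [div_le_one (by positivity)]; linarith)
  have hMσ : 2 * Real.pi / M ≤ σ / 2 := by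
    have : (M : ℝ) = 14 / σ := by
      rw [hM, hσ]; push_cast; rw [one_div, inv_pow, div_inv_eq_mul]
    rw [this, div_div_eq_mul_div, div_le_iff₀ (by norm_num)]
    nlinarith [Real.pi_lt_four, Real.pi_lt_d2]
  have hMΓ : (M : ℝ) ^ #Γ < (1 + c) ^ n := by
    have : (0 : ℝ) < (M : ℝ) ^ #Γ := by positivity
    linarith
  obtain ⟨ρS, hρS1, hρS2, hScard⟩ := exists_regular_radius Γ hMpos (ρ := τ / 2) (σ := 2 * σ)
    (hMσ.trans (by linarith)) (by positivity) hcpos hMΓ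
  obtain ⟨ρP, hρP1, hρP2, hPcard⟩ := exists_regular_radius Γ hMpos (ρ := σ / 2) (σ := σ')
    hMσ hσ'pos.le hcpos hMΓ
  have hρS3 : ρS ≤ τ := by linarith
  have hρP3 : ρP ≤ σ - σ' := by linarith
  set S := bohr Γ ρS with hSdef
  set S' := bohr Γ (ρS + 2 * σ) with hS'def
  set P := bohr Γ ρP with hPdef
  set P' := bohr Γ (ρP + σ') with hP'def
  have hSne : S.Nonempty := ⟨0, zero_mem_bohr _ (by linarith)⟩
  have hPne : P.Nonempty := ⟨0, zero_mem_bohr _ (by linarith)⟩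
  have hPpos : (0 : ℝ) < #P := by exact_mod_cast hPne.card_pos
  -- elements of a finer Bohr set
  have hfine : ∀ Λ', ∀ t ∈ scaleSet a n (Λ ∪ Λ') (m + 2), t ∈ bohr Γ σ' := fun Λ' t ht =>
    bohr_mono (orbit_mono a subset_union_left (by omega)) le_rfl ht
  have hfineS : ∀ t ∈ bohr Γ σ', ∀ s ∈ S, ∀ x ∈ P, s - t - x ∈ S' := by
    intro t ht s hs x hx
    exact bohr_mono Subset.rfl (by linarith) (sub_mem_bohr (sub_mem_bohr hs ht) hx)
  have hcolour : ∀ i, (#{x | a * x ∈ P ∧ x ∈ A i} : ℝ) ≤ 1 / (2 * r) * #P := by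
    intro i
    rcases hk : k i with _ | k'
    · -- a sparse colour
      have h := hterm i ∅ (by simp)
      rw [hk, TransDense] at h
      push Not at h
      obtain ⟨T, hTsub, hTne, hT⟩ := h
      have h1 := card_inter_le_of_sparse (P := ({x | a * x ∈ P} : Finset (ZMod N)))
        (P' := ({x | a * x ∈ P'} : Finset (ZMod N))) hTne (fun y => (hT y).le) (by
          intro p hp t ht
          rw [mem_filter] at hp ⊢
          refine ⟨mem_univ _, ?_⟩
          rw [mul_sub]
          refine sub_mem_bohr hp.2 (mul_mem_bohr_orbit ?_)
          exact bohr_mono (orbit_mono a subset_union_left (by omega)) le_rfl (hTsub ht))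
      have h2 : #{x : ZMod N | a * x ∈ P'} ≤ #P' :=
        card_le_card_of_injOn (a * ·) (fun x hx => by simpa using hx)
          (fun x _ y _ h => ha.mul_left_cancel h)
      have h2' : (#{x : ZMod N | a * x ∈ P'} : ℝ) ≤ #P' := by exact_mod_cast h2
      rw [filter_filter] at h1
      refine h1.trans ?_
      simp only [level, pow_zero, mul_one]
      calc 1 / (4 * (r : ℝ)) * #{x : ZMod N | a * x ∈ P'}
          ≤ 1 / (4 * (r : ℝ)) * ((1 + c) * #P) := by gcongr; exact h2'.trans hPcard
        _ ≤ 1 / (4 * (r : ℝ)) * (2 * #P) := by gcongr; linarith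
        _ = _ := by field_simp; norm_num
    · -- a dense colour
      by_contra! hlarge
      set X : Finset (ZMod N) := ({x | a * x ∈ P ∧ x ∈ A i} : Finset (ZMod N)).image (a * ·) with hX
      have hXcard : #X = #{x | a * x ∈ P ∧ x ∈ A i} :=
        card_image_of_injective _ fun x y h => ha.mul_left_cancel h
      have hXP : X ⊆ P := by
        intro x hx
        obtain ⟨y, hy, rfl⟩ := mem_image.1 hx
        exact (mem_filter.1 hy).2.1
      have hXA : ∀ x ∈ X, ∀ u ∈ A i, ∀ v ∈ A i, u - v ≠ x := by
        intro x hx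
        obtain ⟨y, hy, rfl⟩ := mem_image.1 hx
        exact hfree i y (mem_filter.1 hy).2.2
      have hd := hdense i
      rw [hk] at hd
      have hq := le_level_succ (r := r) k'
      obtain ⟨x₀, hx₀⟩ := hd S (bohr_mono Subset.rfl hρS3) hSne
      obtain ⟨Λ', hΛ'card, hΛ'⟩ := exists_frequencies_density_increment
        (η := 1 / (16 * r)) (ε := 1 / (4 * r)) (c := c) (by positivity) (by positivity)
        (by refine le_trans (le_of_eq ?_) (div_le_div_of_nonneg_right hq (by norm_num : (0:ℝ) ≤ 4))
            field_simp; norm_num)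
        (by rw [hc]; apply le_of_eq; field_simp; norm_num)
        hSne hPne (bohr_mono Subset.rfl (by linarith)) hXP
        (by
          rw [hXcard]
          refine le_trans ?_ hlarge.le
          gcongr
          norm_num)
        hXA hx₀ (hScard.trans (by gcongr; linarith)) hPcard
      refine hterm i Λ' ?_ ?_
      · have h : (#Λ' : ℝ) ≤ 2048 * r ^ 3 := by
          refine hΛ'card.trans (le_of_eq ?_)
          field_simp; norm_num
        exact_mod_cast h
      · intro T hT hTne
        obtain ⟨y, hy⟩ := hΛ' T hTne
          (fun t ht p hp => add_mem_bohr hp (hfine Λ' t (hT ht)))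
          (fun t ht s hs => by
            have := hfineS t (hfine Λ' t (hT ht)) s hs 0 (zero_mem_bohr _ (by linarith))
            rwa [sub_zero] at this)
          (fun t ht => hfineS t (hfine Λ' t (hT ht)))
          (fun t ht l hl => by
            refine (mem_bohr.1 (hT ht) l (subset_orbit _ _ _ (mem_union_right _ hl))).trans ?_
            have h1 : σ' ≤ 1 / (4 * n) := by
              rw [le_div_iff₀ (by positivity)]
              linarith
            refine h1.trans ?_
            rw [div_div]
            exact one_div_le_one_div_of_le (by positivity) (by linarith))
        refine ⟨y, ?_⟩
        rw [hk]
        have hl : level r (k' + 1 + 1) = 101 / 100 * level r (k' + 1) := by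
          simp only [level, pow_succ]; ring
        rw [hl]
        exact hy.le
  -- the colours cover the nonzero elements of the preimage of `P`
  have hPcover : #P ≤ 1 + ∑ i, #{x | a * x ∈ P ∧ x ∈ A i} := by
    obtain ⟨b, hb⟩ := ha.exists_right_inv
    have h1 : #P ≤ #(({0} : Finset (ZMod N)) ∪ univ.biUnion
        fun i => ({x | a * x ∈ P ∧ x ∈ A i} : Finset (ZMod N))) := by
      refine card_le_card_of_injOn (b * ·) ?_ ?_
      · intro x hx
        have hx' : a * (b * x) ∈ P := by rw [← mul_assoc, hb, one_mul]; exact hx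
        simp only [coe_union, coe_singleton, Set.mem_union, Set.mem_singleton_iff, mem_coe,
          mem_biUnion, mem_univ, true_and, mem_filter]
        by_cases h0 : b * x = 0
        · exact Or.inl h0
        · obtain ⟨i, hi⟩ := hcover _ h0
          exact Or.inr ⟨i, hx', hi⟩
      · intro x _ y _ h
        have := congrArg (a * ·) h
        simpa [← mul_assoc, hb] using this
    refine h1.trans ((card_union_le _ _).trans ?_)
    gcongr
    · simp
    · exact card_biUnion_le
  have h1 : (#P : ℝ) ≤ 1 + ∑ i, (#{x | a * x ∈ P ∧ x ∈ A i} : ℝ) := by exact_mod_cast hPcover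
  have h2 : ∑ i, (#{x | a * x ∈ P ∧ x ∈ A i} : ℝ) ≤ #P / 2 := by
    refine (sum_le_card_nsmul _ _ _ fun i _ => hcolour i).trans (le_of_eq ?_)
    rw [card_univ, Fintype.card_fin, nsmul_eq_mul]
    field_simp
  have h3 : (N : ℝ) ≤ (M : ℝ) ^ #Γ * #P := by
    exact_mod_cast le_pow_mul_card_bohr Γ hMpos (hMσ.trans hρP1)
  have h4 : (0 : ℝ) < (M : ℝ) ^ #Γ := by positivity
  have h5 : (M : ℝ) ^ #Γ * 3 < (M : ℝ) ^ #Γ * #P := by linarith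
  have h6 := lt_of_mul_lt_mul_left h5 h4.le
  linarith

/-- The numerical bound governing the sizes of all the Bohr sets that occur. -/
lemma three_mul_pow_le {r s d n : ℕ} (hr : 0 < r) (hs : s ≤ 401 * r ^ 2)
    (hd : d ≤ s * (2048 * r ^ 3) * (2 * s + 1)) (hn : n = (2 * r) ^ 100) :
    3 * ((14 * (4 * n) ^ (2 * s + 1) : ℕ) : ℝ) ^ d ≤ (1 + 1 / (131072 * (r : ℝ) ^ 4)) ^ n := by
  have hr2 : 1 ≤ r ^ 2 := Nat.one_le_pow _ _ hr
  have hn14 : 14 ≤ 4 * n := by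
    have : 2 ^ 100 ≤ n := by rw [hn]; exact Nat.pow_le_pow_left (by omega) _
    have : 14 ≤ 2 ^ 100 := by norm_num
    omega
  have hbase : 4 * n ≤ 2 ^ (202 * r) := by
    calc 4 * n ≤ 2 ^ 2 * (2 ^ (2 * r)) ^ 100 := by
          rw [hn]; gcongr
          · norm_num
          · exact Nat.lt_two_pow_self.le
      _ = 2 ^ (2 + 200 * r) := by rw [← pow_mul, ← pow_add]; congr 1; ring
      _ ≤ 2 ^ (202 * r) := Nat.pow_le_pow_right (by norm_num) (by omega)
  have hd' : d ≤ 659462144 * r ^ 7 := by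
    refine hd.trans ?_
    calc s * (2048 * r ^ 3) * (2 * s + 1)
        ≤ (401 * r ^ 2) * (2048 * r ^ 3) * (803 * r ^ 2) := by gcongr; omega
      _ = 659462144 * r ^ 7 := by ring
  have hexp : 202 * r * ((2 * s + 2) * d + 1) ≤ 2 ^ 83 * r ^ 96 := by
    have h1 : (2 * s + 2) * d + 1 ≤ 10 ^ 12 * r ^ 9 := by
      have : 1 ≤ r ^ 9 := Nat.one_le_pow _ _ hr
      calc (2 * s + 2) * d + 1 ≤ (804 * r ^ 2) * (659462144 * r ^ 7) + r ^ 9 := by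
            gcongr; omega
        _ = (804 * 659462144 + 1) * r ^ 9 := by ring
        _ ≤ 10 ^ 12 * r ^ 9 := by gcongr; norm_num
    calc 202 * r * ((2 * s + 2) * d + 1) ≤ 202 * r * (10 ^ 12 * r ^ 9) := by gcongr
      _ = (202 * 10 ^ 12) * r ^ 10 := by ring
      _ ≤ 2 ^ 83 * r ^ 96 := by
          gcongr
          · norm_num
          · norm_num
  have hleft : 3 * (14 * (4 * n) ^ (2 * s + 1)) ^ d ≤ 2 ^ (2 ^ 83 * r ^ 96) := by
    calc 3 * (14 * (4 * n) ^ (2 * s + 1)) ^ d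
        ≤ (4 * n) * ((4 * n) * (4 * n) ^ (2 * s + 1)) ^ d := by gcongr; omega
      _ = (4 * n) ^ ((2 * s + 2) * d + 1) := by
          rw [← pow_succ', ← pow_mul, ← pow_succ']
      _ ≤ (2 ^ (202 * r)) ^ ((2 * s + 2) * d + 1) := by gcongr
      _ = 2 ^ (202 * r * ((2 * s + 2) * d + 1)) := by rw [← pow_mul]
      _ ≤ 2 ^ (2 ^ 83 * r ^ 96) := Nat.pow_le_pow_right (by norm_num) hexp
  have hnfac : n = 131072 * r ^ 4 * (2 ^ 83 * r ^ 96) := by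
    rw [hn, mul_pow]; ring
  have hrR : (0 : ℝ) < r := by exact_mod_cast hr
  have htwo : (2 : ℝ) ≤ (1 + 1 / (131072 * (r : ℝ) ^ 4)) ^ (131072 * r ^ 4) := by
    have h := one_add_mul_le_pow (a := 1 / (131072 * (r : ℝ) ^ 4))
      (le_trans (by norm_num) (by positivity : (0 : ℝ) ≤ _)) (131072 * r ^ 4)
    refine le_trans (le_of_eq ?_) h
    push_cast
    field_simp
    norm_num
  calc 3 * ((14 * (4 * n) ^ (2 * s + 1) : ℕ) : ℝ) ^ d
      ≤ (2 : ℝ) ^ (2 ^ 83 * r ^ 96) := by exact_mod_cast hleft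
    _ ≤ ((1 + 1 / (131072 * (r : ℝ) ^ 4)) ^ (131072 * r ^ 4)) ^ (2 ^ 83 * r ^ 96) := by gcongr
    _ = (1 + 1 / (131072 * (r : ℝ) ^ 4)) ^ n := by rw [← pow_mul, ← hnfac]

/-- The bound for colourings given by their colour classes. -/
lemma card_le_of_free {a : ZMod N} (ha : IsUnit a) {r : ℕ} (hr : 0 < r)
    {A : Fin r → Finset (ZMod N)} (hcover : ∀ x, x ≠ 0 → ∃ i, x ∈ A i)
    (hfree : ∀ i, ∀ x ∈ A i, ∀ u ∈ A i, ∀ v ∈ A i, u - v ≠ a * x) :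
    (N : ℝ) ≤ (1 + 1 / (131072 * (r : ℝ) ^ 4)) ^ ((2 * r) ^ 100) := by
  classical
  by_contra! hN
  obtain ⟨n, hn⟩ : ∃ n, n = (2 * r) ^ 100 := ⟨_, rfl⟩
  rw [← hn] at hN
  have hn8 : 8 * r ≤ n := by
    have h1 : 1 ≤ (2 * r) ^ 97 := Nat.one_le_pow _ _ (by omega)
    have h2 : 1 ≤ r ^ 2 := Nat.one_le_pow _ _ hr
    calc 8 * r = 8 * r * 1 * 1 := by ring
      _ ≤ 8 * r * r ^ 2 * (2 * r) ^ 97 := by gcongr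
      _ = n := by rw [hn]; ring
  have hn0 : 0 < n := by omega
  have hlevel : ∀ (Λ : Finset (ZMod N)) (m : ℕ) (i : Fin r) (k : ℕ),
      TransDense (A i) (scaleSet a n Λ m) (level r k) → k ≤ 401 * r := fun Λ m i k h =>
    le_of_level_le_one hr (h.le_one ⟨0, zero_mem_bohr _ (by positivity)⟩)
  have hstate : ∀ s : ℕ, ∃ (Λ : Finset (ZMod N)) (k : Fin r → ℕ), ∑ i, k i = s ∧
      #Λ ≤ s * (2048 * r ^ 3) ∧
      ∀ i, TransDense (A i) (scaleSet a n Λ (2 * s)) (level r (k i)) := by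
    intro s
    induction s with
    | zero =>
      refine ⟨∅, 0, by simp, by simp, fun i S _ _ => ⟨0, ?_⟩⟩
      simp [level]
    | succ s ih =>
      obtain ⟨Λ, k, hks, hΛ, hdense⟩ := ih
      have hs : s ≤ 401 * r ^ 2 := by
        rw [← hks]
        refine (sum_le_card_nsmul _ _ _ fun i _ => hlevel _ _ i _ (hdense i)).trans (le_of_eq ?_)
        rw [card_univ, Fintype.card_fin, smul_eq_mul]; ring
      obtain ⟨i, Λ', hΛ', hinc⟩ := exists_density_increment ha hr hcover hfree hn8
        (three_mul_pow_le hr hs ((card_orbit_le a Λ (2 * s)).trans (by gcongr)) hn) hN hdense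
      refine ⟨Λ ∪ Λ', Function.update k i (k i + 1), ?_, ?_, ?_⟩
      · rw [sum_update_of_mem (mem_univ i), ← hks, ← add_sum_erase univ k (mem_univ i),
          ← erase_eq]
        ring
      · refine (card_union_le _ _).trans ?_
        rw [add_mul, one_mul]
        gcongr
      · intro j
        by_cases hj : j = i
        · subst hj
          rw [Function.update_self]; exact hinc
        · rw [Function.update_of_ne hj]
          exact (hdense j).mono (scaleSet_anti a hn0 subset_union_left (by omega))
  obtain ⟨Λ, k, hks, -, hdense⟩ := hstate (401 * r ^ 2 + 1)
  have : ∑ i, k i ≤ 401 * r ^ 2 := by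
    refine (sum_le_card_nsmul _ _ _ fun i _ => hlevel _ _ i _ (hdense i)).trans (le_of_eq ?_)
    rw [card_univ, Fintype.card_fin, smul_eq_mul]; ring
  omega

end Iteration

end ModularSchur

/-- There is an absolute constant `C > 0` such that: if `a, N ∈ ℕ` are coprime and
`(ℤ/Nℤ)*` is `r`-coloured so that there is no monochromatic triple of nonzero elements
`(x₁, x₂, x₃)` with `a·x₁ + x₂ - x₃ = 0` in `ℤ/Nℤ`, then `N ≤ exp((2r)^C)`. -/
theorem modular_generalised_schur_bounded :
    ∃ C : ℝ, 0 < C ∧ ∀ a N r : ℕ, Nat.Coprime a N → 0 < r →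
      ∀ χ : ZMod N → Fin r,
        (¬ ∃ x₁ x₂ x₃ : ZMod N, x₁ ≠ 0 ∧ x₂ ≠ 0 ∧ x₃ ≠ 0 ∧
          χ x₁ = χ x₂ ∧ χ x₁ = χ x₃ ∧ (a : ZMod N) * x₁ + x₂ - x₃ = 0) →
        (N : ℝ) ≤ Real.exp ((2 * (r : ℝ)) ^ C) := by
  classical
  refine ⟨100, by norm_num, fun a N r hcop hr χ hχ => ?_⟩
  rcases Nat.eq_zero_or_pos N with rfl | hN
  · simpa using (Real.exp_pos _).le
  have : NeZero N := ⟨hN.ne'⟩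
  have hmain := ModularSchur.card_le_of_free (a := (a : ZMod N))
    ((ZMod.isUnit_iff_coprime a N).2 hcop) hr
    (A := fun i => ({x | x ≠ 0 ∧ χ x = i} : Finset (ZMod N)))
    (fun x hx => ⟨χ x, by simp [hx]⟩) (by
      intro i x hx u hu v hv huv
      rw [Finset.mem_filter] at hx hu hv
      refine hχ ⟨x, v, u, hx.2.1, hv.2.1, hu.2.1, hx.2.2.trans hv.2.2.symm,
        hx.2.2.trans hu.2.2.symm, ?_⟩
      rw [← huv]; ring)
  refine hmain.trans ?_
  have hrR : (1 : ℝ) ≤ r := by exact_mod_cast hr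
  have hc : 1 + 1 / (131072 * (r : ℝ) ^ 4) ≤ Real.exp 1 := by
    have h1 : 1 / (131072 * (r : ℝ) ^ 4) ≤ 1 := by
      rw [div_le_one (by positivity)]
      linarith [one_le_pow₀ hrR (n := 4)]
    linarith [Real.add_one_le_exp 1]
  calc (1 + 1 / (131072 * (r : ℝ) ^ 4)) ^ ((2 * r) ^ 100)
      ≤ Real.exp 1 ^ ((2 * r) ^ 100) := by gcongr
    _ = Real.exp ((2 * (r : ℝ)) ^ (100 : ℝ)) := by
        rw [← Real.exp_nat_mul, mul_one]
        congr 1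
        rw [show (100 : ℝ) = ((100 : ℕ) : ℝ) by norm_num, Real.rpow_natCast]
        push_cast
        rfl
end
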